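/- arXiv:0911.4200 — 3 statements merged into one kernel-verified Lean document; each statement's English description precedes it below -/
import Mathlib

section
/- Let T be an ℝ-tree and let G be a group with a non-nesting action on T by weak homeomorphisms. Suppose h₁, h₂ ∈ G are loxodromic and conjugate to each other, and that g = h₂h₁ is conjugate to h₁⁶ or to h₁⁻⁶. Then L_{h₁} ∩ L_{h₂} = ∅. -/
open Set

/-- A topologically embedded arc in `T` joining `x` to `y`, given as a subset:
the image of a continuous injective map on `[0,1]` with endpoints `x` and `y`
(such a map is automatically a topological embedding). -/
def IsArc {T : Type*} [MetricSpace T] (A : Set T) (x y : T) : Prop :=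
  ∃ f : ℝ → T, ContinuousOn f (Icc (0 : ℝ) 1) ∧ InjOn f (Icc (0 : ℝ) 1) ∧
    f '' Icc (0 : ℝ) 1 = A ∧ f 0 = x ∧ f 1 = y

/-- `A ⊆ T` is isometric to a closed bounded interval of `ℝ`. -/
def IsIsometricToInterval {T : Type*} [MetricSpace T] (A : Set T) : Prop :=
  ∃ (a b : ℝ) (f : ℝ → T), a ≤ b ∧
    (∀ s ∈ Icc a b, ∀ t ∈ Icc a b, dist (f s) (f t) = |s - t|) ∧
    f '' Icc a b = A

/-- An `ℝ`-tree: a metric space in which any two distinct points are joined by a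
unique topologically embedded arc, and this arc is isometric to a closed bounded
interval of `ℝ`. -/
structure IsRTree (T : Type*) [MetricSpace T] : Prop where
  arc_existsUnique : ∀ ⦃x y : T⦄, x ≠ y → ∃! A : Set T, IsArc A x y
  arc_isometric : ∀ ⦃x y : T⦄, x ≠ y → ∀ A : Set T, IsArc A x y → IsIsometricToInterval A

open scoped Classical in
/-- The segment `[x,y]`: the unique arc joining `x` to `y` if `x ≠ y`
(computed as the intersection of all such arcs), and `{x}` if `x = y`. -/
noncomputable def seg {T : Type*} [MetricSpace T] (x y : T) : Set T :=
  if x = y then {x} else ⋂₀ {A : Set T | IsArc A x y}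

/-- Betweenness: `Btwn x y z` iff `x ∈ [y,z] \ {y,z}`. -/
def Btwn {T : Type*} [MetricSpace T] (x y z : T) : Prop :=
  x ∈ seg y z ∧ x ≠ y ∧ x ≠ z

/-- A weak homeomorphism of `T`: a bijection preserving the betweenness relation. -/
def IsWeakHomeo {T : Type*} [MetricSpace T] (g : T → T) : Prop :=
  Function.Bijective g ∧ ∀ x y z : T, Btwn x y z ↔ Btwn (g x) (g y) (g z)

/-- Convex subsets (subtrees) of `T`. -/
def ConvexSubtree {T : Type*} [MetricSpace T] (S : Set T) : Prop :=
  ∀ x ∈ S, ∀ y ∈ S, seg x y ⊆ S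

/-- The action of `G` on `T` is by weak homeomorphisms. -/
def ActsByWeakHomeos (G T : Type*) [Group G] [MulAction G T] [MetricSpace T] : Prop :=
  ∀ g : G, IsWeakHomeo (fun t : T => g • t)

/-- The action of `G` on `T` is non-nesting: no segment is mapped properly into itself. -/
def NonNesting (G T : Type*) [Group G] [MulAction G T] [MetricSpace T] : Prop :=
  ∀ (g : G) (x y : T), ¬ ((fun t : T => g • t) '' seg x y ⊂ seg x y)

/-- The fixed-point set `T^g` of a group element. -/
def fixedSet (T : Type*) {G : Type*} [Group G] [MulAction G T] (g : G) : Set T :=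
  {t : T | g • t = t}

/-- `x, y, z` span a tripod: the median of `x, y, z` lies in none of `{x,y,z}`. -/
def IsTripod {T : Type*} [MetricSpace T] (x y z : T) : Prop :=
  ∀ c ∈ seg x y ∩ seg y z ∩ seg z x, c ≠ x ∧ c ≠ y ∧ c ≠ z

/-- `S` contains no tripod. -/
def NoTripod {T : Type*} [MetricSpace T] (S : Set T) : Prop :=
  ¬ ∃ x y z : T, IsTripod x y z ∧ seg x y ∪ seg y z ∪ seg z x ⊆ S

/-- A line: a convex subset containing no tripod, maximal for inclusion. -/
def IsLine {T : Type*} [MetricSpace T] (L : Set T) : Prop :=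
  ConvexSubtree L ∧ NoTripod L ∧
    ∀ L' : Set T, ConvexSubtree L' → NoTripod L' → L ⊆ L' → L' = L

/-- `L` is an axis for `g`: a `g`-invariant line. -/
def IsAxis {G T : Type*} [Group G] [MulAction G T] [MetricSpace T] (g : G) (L : Set T) :
    Prop :=
  IsLine L ∧ (fun t : T => g • t) '' L = L


namespace AxD

/-- Metric betweenness. -/
def Bt {T : Type*} [MetricSpace T] (a b c : T) : Prop := dist a b + dist b c = dist a c

section basics
variable {T : Type*} [MetricSpace T]

lemma Bt.symm {a b c : T} (h : Bt a b c) : Bt c b a := by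
  unfold Bt at *
  rw [dist_comm c b, dist_comm b a, dist_comm c a]; linarith

lemma seg_eq_of_arc (hT : IsRTree T) {x y : T} (hxy : x ≠ y) {A : Set T} (hA : IsArc A x y) :
    A = seg x y := by
  unfold seg
  rw [if_neg hxy]
  apply Subset.antisymm
  · intro p hp B hB
    rw [(hT.arc_existsUnique hxy).unique (show IsArc B x y from hB) hA]; exact hp
  · intro p hp
    exact hp A hA

lemma arc_of_lip (hT : IsRTree T) {x y : T} (hxy : x ≠ y) {d : ℝ} (hd : 0 < d) (φ : ℝ → T)
    (hl : ∀ s ∈ Icc 0 d, ∀ t ∈ Icc 0 d, s ≤ t → dist (φ s) (φ t) ≤ t - s)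
    (hi : ∀ s ∈ Icc 0 d, ∀ t ∈ Icc 0 d, s ≤ t → φ s = φ t → s = t)
    (h0 : φ 0 = x) (h1 : φ d = y) : φ '' Icc 0 d = seg x y := by
  apply seg_eq_of_arc hT hxy
  have hmem : ∀ u ∈ Icc (0:ℝ) 1, u * d ∈ Icc 0 d := fun u hu =>
    ⟨mul_nonneg hu.1 hd.le, by nlinarith [hu.2]⟩
  refine ⟨fun u => φ (u * d), ?_, ?_, ?_, by simpa using h0, by simpa using h1⟩
  · have hL : LipschitzOnWith 1 φ (Icc 0 d) := by
      apply LipschitzOnWith.of_dist_le_mul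
      intro s hs t ht
      rw [NNReal.coe_one, one_mul, Real.dist_eq]
      rcases le_total s t with h | h
      · rw [abs_sub_comm, abs_of_nonneg (by linarith)]; exact hl s hs t ht h
      · rw [abs_of_nonneg (by linarith), dist_comm]; exact hl t ht s hs h
    exact hL.continuousOn.comp (by fun_prop) hmem
  · intro u hu v hv h
    have : u * d = v * d := by
      rcases le_total (u * d) (v * d) with h' | h'
      · exact hi _ (hmem u hu) _ (hmem v hv) h' h
      · exact (hi _ (hmem v hv) _ (hmem u hu) h' h.symm).symm
    exact mul_right_cancel₀ hd.ne' this
  · ext p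
    constructor
    · rintro ⟨u, hu, rfl⟩
      exact ⟨u * d, hmem u hu, rfl⟩
    · rintro ⟨t, ht, rfl⟩
      refine ⟨t / d, ⟨div_nonneg ht.1 hd.le, (div_le_one hd).2 ht.2⟩, ?_⟩
      simp [div_mul_cancel₀ _ hd.ne']

/-- Isometric parametrization of the segment. -/
lemma exists_param (hT : IsRTree T) {x y : T} (hxy : x ≠ y) :
    ∃ φ : ℝ → T, (∀ s ∈ Icc 0 (dist x y), ∀ t ∈ Icc 0 (dist x y), s ≤ t →
      dist (φ s) (φ t) = t - s) ∧ φ 0 = x ∧ φ (dist x y) = y ∧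
      φ '' Icc 0 (dist x y) = seg x y := by
  obtain ⟨A, hA, -⟩ := hT.arc_existsUnique hxy
  obtain ⟨a, b, f, hab, hf, hfA⟩ := hT.arc_isometric hxy A hA
  have hxA : x ∈ A := by
    obtain ⟨γ, -, -, h, h0, -⟩ := hA
    rw [← h]; exact ⟨0, by simp, h0⟩
  have hyA : y ∈ A := by
    obtain ⟨γ, -, -, h, -, h0⟩ := hA
    rw [← h]; exact ⟨1, by simp, h0⟩
  rw [← hfA] at hxA hyA
  obtain ⟨s, hs, hsx⟩ := hxA
  obtain ⟨t, ht, hty⟩ := hyA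
  have hd : dist x y = |s - t| := by rw [← hsx, ← hty, hf s hs t ht]
  have hpos : 0 < dist x y := dist_pos.2 hxy
  rcases le_total s t with h | h
  · rw [abs_of_nonpos (by linarith)] at hd
    have hm : ∀ u ∈ Icc 0 (dist x y), s + u ∈ Icc a b := fun u hu =>
      ⟨by linarith [hs.1, hu.1], by linarith [ht.2, hu.2]⟩
    have key : ∀ u ∈ Icc 0 (dist x y), ∀ v ∈ Icc 0 (dist x y), u ≤ v →
        dist (f (s + u)) (f (s + v)) = v - u := by
      intro u hu v hv huv
      rw [hf _ (hm u hu) _ (hm v hv), abs_of_nonpos (by linarith)]; ring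
    have e0 : f (s + 0) = x := by simpa using hsx
    have e1 : f (s + dist x y) = y := by
      rw [hd, ← hty]; congr 1; ring
    refine ⟨fun u => f (s + u), key, e0, e1, ?_⟩
    refine arc_of_lip hT hxy hpos _ (fun u hu v hv huv => (key u hu v hv huv).le) ?_ e0 e1
    intro u hu v hv huv h
    have := key u hu v hv huv
    rw [h, dist_self] at this; linarith
  · rw [abs_of_nonneg (by linarith)] at hd
    have hm : ∀ u ∈ Icc 0 (dist x y), s - u ∈ Icc a b := fun u hu =>
      ⟨by linarith [ht.1, hu.2], by linarith [hs.2, hu.1]⟩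
    have key : ∀ u ∈ Icc 0 (dist x y), ∀ v ∈ Icc 0 (dist x y), u ≤ v →
        dist (f (s - u)) (f (s - v)) = v - u := by
      intro u hu v hv huv
      rw [hf _ (hm u hu) _ (hm v hv), abs_of_nonneg (by linarith)]; ring
    have e0 : f (s - 0) = x := by simpa using hsx
    have e1 : f (s - dist x y) = y := by
      rw [hd, ← hty]; congr 1; ring
    refine ⟨fun u => f (s - u), key, e0, e1, ?_⟩
    refine arc_of_lip hT hxy hpos _ (fun u hu v hv huv => (key u hu v hv huv).le) ?_ e0 e1
    intro u hu v hv huv h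
    have := key u hu v hv huv
    rw [h, dist_self] at this; linarith

lemma seg_self (x : T) : seg x x = {x} := by simp [seg]

lemma bt_of_mem_seg (hT : IsRTree T) {x y p : T} (h : p ∈ seg x y) : Bt x p y := by
  by_cases hxy : x = y
  · subst hxy
    rw [seg_self, mem_singleton_iff] at h
    subst h; simp [Bt]
  · obtain ⟨φ, hφ, h0, h1, him⟩ := exists_param hT hxy
    rw [← him] at h
    obtain ⟨t, ht, rfl⟩ := h
    have a := hφ 0 ⟨le_rfl, dist_nonneg⟩ t ht ht.1
    have b := hφ t ht _ ⟨dist_nonneg, le_rfl⟩ ht.2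
    rw [h0] at a; rw [h1] at b
    unfold Bt; linarith

lemma geo (hT : IsRTree T) (x y : T) {t : ℝ} (ht : t ∈ Icc 0 (dist x y)) :
    ∃ p, p ∈ seg x y ∧ dist x p = t := by
  by_cases hxy : x = y
  · subst hxy
    rw [dist_self] at ht
    exact ⟨x, by simp [seg_self], by rw [dist_self]; exact le_antisymm ht.1 ht.2⟩
  · obtain ⟨φ, hφ, h0, h1, him⟩ := exists_param hT hxy
    refine ⟨φ t, him ▸ ⟨t, ht, rfl⟩, ?_⟩
    have a := hφ 0 ⟨le_rfl, dist_nonneg⟩ t ht ht.1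
    rw [h0] at a; linarith

lemma left_mem_seg (hT : IsRTree T) (x y : T) : x ∈ seg x y := by
  obtain ⟨p, hp, h⟩ := geo hT x y (t := 0) ⟨le_rfl, dist_nonneg⟩
  have := dist_eq_zero.1 h
  subst this; exact hp

lemma right_mem_seg (hT : IsRTree T) (x y : T) : y ∈ seg x y := by
  obtain ⟨p, hp, h⟩ := geo hT x y (t := dist x y) ⟨dist_nonneg, le_rfl⟩
  have := bt_of_mem_seg hT hp
  unfold Bt at this
  have h2 : dist p y = 0 := by linarith
  have := dist_eq_zero.1 h2
  subst this; exact hp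

/-- Concatenation of segments meeting in one point. -/
lemma concat_seg (hT : IsRTree T) {x p y : T}
    (h : ∀ q, q ∈ seg x p → q ∈ seg p y → q = p) : p ∈ seg x y := by
  by_cases hxp : x = p
  · subst hxp; exact left_mem_seg hT _ _
  by_cases hpy : p = y
  · subst hpy; exact right_mem_seg hT _ _
  have hxy : x ≠ y := by
    rintro rfl
    apply hxp
    exact h x (left_mem_seg hT _ _) (right_mem_seg hT _ _)
  obtain ⟨φ, hφ, h0, h1, him⟩ := exists_param hT hxp
  obtain ⟨ψ, hψ, k0, k1, kim⟩ := exists_param hT hpy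
  have dp := dist_pos.2 hxp
  have dq := dist_pos.2 hpy
  set d := dist x p with hd
  set e := dist p y with he
  let θ : ℝ → T := fun t => if t ≤ d then φ t else ψ (t - d)
  have hθ1 : ∀ t, t ≤ d → θ t = φ t := fun t ht => if_pos ht
  have hθ2 : ∀ t, d < t → θ t = ψ (t - d) := fun t ht => if_neg (not_le.2 ht)
  have him2 := arc_of_lip hT hxy (d := d + e) (by linarith) θ ?_ ?_ ?_ ?_
  · rw [← him2]
    exact ⟨d, ⟨by linarith, by linarith⟩, by rw [hθ1 d le_rfl, h1]⟩
  · intro s hs t ht hst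
    by_cases h2 : t ≤ d
    · rw [hθ1 t h2, hθ1 s (by linarith)]
      exact (hφ s ⟨hs.1, by linarith⟩ t ⟨ht.1, h2⟩ hst).le
    · push Not at h2
      rw [hθ2 t h2]
      by_cases h3 : s ≤ d
      · rw [hθ1 s h3]
        have a := hφ s ⟨hs.1, h3⟩ d ⟨dp.le, le_rfl⟩ h3
        have b := hψ 0 ⟨le_rfl, dq.le⟩ (t - d) ⟨by linarith, by linarith [ht.2]⟩ (by linarith)
        rw [h1] at a; rw [k0] at b
        have := dist_triangle (φ s) p (ψ (t - d))
        linarith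
      · push Not at h3
        rw [hθ2 s h3]
        have b := hψ (s - d) ⟨by linarith, by linarith [hs.2]⟩ (t - d)
          ⟨by linarith, by linarith [ht.2]⟩ (by linarith)
        linarith
  · intro s hs t ht hst heq
    by_cases h2 : t ≤ d
    · rw [hθ1 t h2, hθ1 s (by linarith)] at heq
      have := hφ s ⟨hs.1, by linarith⟩ t ⟨ht.1, h2⟩ hst
      rw [heq, dist_self] at this; linarith
    · push Not at h2
      rw [hθ2 t h2] at heq
      by_cases h3 : s ≤ d
      · rw [hθ1 s h3] at heq
        have b := hψ 0 ⟨le_rfl, dq.le⟩ (t - d) ⟨by linarith, by linarith [ht.2]⟩ (by linarith)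
        have := h (φ s) (him ▸ ⟨s, ⟨hs.1, h3⟩, rfl⟩)
          (by rw [heq, ← kim]; exact ⟨t - d, ⟨by linarith, by linarith [ht.2]⟩, rfl⟩)
        rw [← heq, this, k0, dist_self] at b
        linarith
      · push Not at h3
        rw [hθ2 s h3] at heq
        have b := hψ (s - d) ⟨by linarith, by linarith [hs.2]⟩ (t - d)
          ⟨by linarith, by linarith [ht.2]⟩ (by linarith)
        rw [heq, dist_self] at b; linarith
  · rw [hθ1 0 dp.le, h0]
  · rw [hθ2 _ (by linarith), add_sub_cancel_left, k1]

lemma mem_seg_iff (hT : IsRTree T) {x y p : T} : p ∈ seg x y ↔ Bt x p y := by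
  refine ⟨bt_of_mem_seg hT, fun h => concat_seg hT fun q h1 h2 => ?_⟩
  have a := bt_of_mem_seg hT h1
  have b := bt_of_mem_seg hT h2
  unfold Bt at *
  have := dist_triangle x q y
  rw [dist_comm p q] at b
  apply dist_eq_zero.1
  linarith [dist_nonneg (x := q) (y := p)]

lemma median (hT : IsRTree T) (x y z : T) : ∃ c, Bt x c y ∧ Bt x c z ∧ Bt y c z := by
  have hcpt : ∀ u v : T, IsCompact (seg u v) := by
    intro u v
    by_cases huv : u = v
    · subst huv; rw [seg_self]; exact isCompact_singleton
    · obtain ⟨A, hA, -⟩ := hT.arc_existsUnique huv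
      rw [← seg_eq_of_arc hT huv hA]
      obtain ⟨γ, hc, -, h, -⟩ := hA
      rw [← h]; exact isCompact_Icc.image_of_continuousOn hc
  have hK : IsCompact (seg x y ∩ seg x z) := (hcpt x y).inter (hcpt x z)
  obtain ⟨c, ⟨hc1, hc2⟩, hmax⟩ := hK.exists_isMaxOn
    ⟨x, left_mem_seg hT _ _, left_mem_seg hT _ _⟩
    (f := fun p => dist x p) (by fun_prop)
  rw [mem_seg_iff hT] at hc1 hc2
  refine ⟨c, hc1, hc2, ?_⟩
  rw [← mem_seg_iff hT]
  apply concat_seg hT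
  intro q h1 h2
  rw [mem_seg_iff hT] at h1 h2
  unfold Bt at *
  have t1 := dist_triangle x q y
  have t2 := dist_triangle x q z
  have t3 := dist_triangle x c q
  rw [dist_comm y q, dist_comm q c, dist_comm y c] at h1
  have := hmax (a := q) ⟨(mem_seg_iff hT).2 (by unfold Bt; linarith),
    (mem_seg_iff hT).2 (by unfold Bt; linarith)⟩
  simp only [mem_ofPred_eq] at this
  apply dist_eq_zero.1
  rw [dist_comm q c]
  linarith [dist_nonneg (x := c) (y := q)]

/-- The four point condition. -/
lemma four (hT : IsRTree T) (x y z w : T) :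
    dist x z + dist y w ≤ dist x y + dist z w ∨ dist x z + dist y w ≤ dist x w + dist y z := by
  obtain ⟨c, c1, c2, c3⟩ := median hT w x y
  obtain ⟨e, e1, e2, e3⟩ := median hT w y z
  -- `c`, `e` both in `[w,y]`
  have hlin : Bt w c e ∨ Bt w e c := by
    by_cases hle : dist w c ≤ dist w e
    · left
      obtain ⟨q, hq, hqd⟩ := geo hT w e (t := dist w c) ⟨dist_nonneg, hle⟩
      have hq := (mem_seg_iff hT).1 hq
      have : q = c := by
        by_cases hwy : w = y
        · subst hwy
          unfold Bt at *
          rw [dist_self] at c2 e1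
          have a0 := dist_nonneg (x := w) (y := c)
          have a1 := dist_nonneg (x := c) (y := w)
          have a2 : dist w c = 0 := by linarith
          rw [a2] at hqd
          rw [← dist_eq_zero.1 hqd, ← dist_eq_zero.1 a2]
        obtain ⟨φ, hφ, h0, h1, him⟩ := exists_param hT hwy
        have key : ∀ q, Bt w q y → q = φ (dist w q) := by
          intro q hq
          have := (mem_seg_iff hT).2 hq
          rw [← him] at this
          obtain ⟨t, ht, rfl⟩ := this
          have := hφ 0 ⟨le_rfl, dist_nonneg⟩ t ht ht.1
          rw [h0] at this
          rw [this, sub_zero]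
        rw [key c c2, key q ?_, hqd]
        unfold Bt at *
        have t1 := dist_triangle w q y
        have t2 := dist_triangle q e y
        linarith
      rwa [← this]
    · right
      push Not at hle
      obtain ⟨q, hq, hqd⟩ := geo hT w c (t := dist w e) ⟨dist_nonneg, hle.le⟩
      have hq := (mem_seg_iff hT).1 hq
      have : q = e := by
        by_cases hwy : w = y
        · subst hwy
          unfold Bt at *
          rw [dist_self] at c2 e1
          have a0 := dist_nonneg (x := w) (y := c)
          have a1 := dist_nonneg (x := c) (y := w)
          have a2 := dist_nonneg (x := w) (y := e)
          linarith
        obtain ⟨φ, hφ, h0, h1, him⟩ := exists_param hT hwy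
        have key : ∀ q, Bt w q y → q = φ (dist w q) := by
          intro q hq
          have := (mem_seg_iff hT).2 hq
          rw [← him] at this
          obtain ⟨t, ht, rfl⟩ := this
          have := hφ 0 ⟨le_rfl, dist_nonneg⟩ t ht ht.1
          rw [h0] at this
          rw [this, sub_zero]
        rw [key e e1, key q ?_, hqd]
        unfold Bt at *
        have t1 := dist_triangle w q y
        have t2 := dist_triangle q c y
        linarith
      rwa [← this]
  unfold Bt at *
  have d1 := dist_comm x w
  have d2 := dist_comm y w
  have d3 := dist_comm z w
  have d4 := dist_comm x c
  have d5 := dist_comm y c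
  have d6 := dist_comm y e
  have d7 := dist_comm c e
  have d8 := dist_comm z e
  have d9 := dist_comm z c
  have d10 := dist_comm x e
  have t1 := dist_triangle x c z
  have t2 := dist_triangle x e z
  have t3 := dist_triangle c e z
  have t4 := dist_triangle x c e
  have t5 := dist_triangle e c x
  rcases hlin with h | h
  · left; linarith
  · right; linarith

end basics

section tree
variable {T : Type*} [MetricSpace T]

lemma Bt.tr1 {a b c d : T} (h1 : Bt a b c) (h2 : Bt a c d) : Bt a b d := by
  unfold Bt at *
  linarith [dist_triangle a b d, dist_triangle b c d]

lemma Bt.tr2 {a b c d : T} (h1 : Bt a b c) (h2 : Bt a c d) : Bt b c d := by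
  unfold Bt at *
  linarith [dist_triangle a b d, dist_triangle b c d]

lemma bt_left (a b : T) : Bt a a b := by simp [Bt]
lemma bt_right (a b : T) : Bt a b b := by simp [Bt]

lemma concat (hT : IsRTree T) {a b c d : T} (h1 : Bt a b c) (h2 : Bt b c d) (hne : b ≠ c) :
    Bt a b d ∧ Bt a c d := by
  have hp := dist_pos.2 hne
  have t1 := dist_triangle a b d
  have t2 := dist_triangle a c d
  unfold Bt at *
  rcases four hT a b c d with h | h <;> constructor <;> linarith

/-- `[a,c] ⊆ [a,b] ∪ [b,c]`. -/
lemma split (hT : IsRTree T) {a c p : T} (b : T) (h : Bt a p c) : Bt a p b ∨ Bt b p c := by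
  have t1 := dist_triangle a p b
  have t2 := dist_triangle b p c
  have e1 := dist_comm p b
  have e2 := dist_comm c p
  have e3 := dist_comm c b
  unfold Bt at *
  rcases four hT a b c p with h | h
  · left; linarith
  · right; linarith

lemma lin (hT : IsRTree T) {x y p q : T} (h1 : Bt x p y) (h2 : Bt x q y)
    (h : dist x p ≤ dist x q) : Bt x p q := by
  have t1 := dist_triangle x p q
  have e1 := dist_comm p y
  have e2 := dist_comm q y
  have e3 := dist_nonneg (x := p) (y := q)
  unfold Bt at *
  rcases four hT x p y q with h | h <;> linarith

lemma conv (hT : IsRTree T) {x y p q r : T} (h1 : Bt x p y) (h2 : Bt x q y)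
    (h : Bt p r q) : Bt x r y := by
  rcases le_total (dist x p) (dist x q) with hle | hle
  · exact (h.symm.tr1 (lin hT h1 h2 hle).symm).symm.tr1 h2
  · exact (h.tr1 (lin hT h2 h1 hle).symm).symm.tr1 h1

lemma uniq (hT : IsRTree T) {x y p q : T} (h1 : Bt x p y) (h2 : Bt x q y)
    (h : dist x p = dist x q) : p = q := by
  have := lin hT h1 h2 h.le
  unfold Bt at this
  exact dist_eq_zero.1 (by linarith)

lemma anti {x s s' : T} (h1 : Bt x s s') (h2 : Bt x s' s) : s = s' := by
  unfold Bt at *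
  have := dist_comm s s'
  exact dist_eq_zero.1 (by linarith)

lemma dist_le_of_bt {a b p q : T} (h1 : Bt a p b) (h2 : Bt a q b) : dist p q ≤ dist a b := by
  unfold Bt at *
  have t1 := dist_triangle p a q
  have t2 := dist_triangle p b q
  have e1 := dist_comm p a
  have e2 := dist_comm q b
  linarith

lemma fix_real (F : ℝ → ℝ) (d : ℝ) (hd : 0 ≤ d) (hF : ∀ t ∈ Icc 0 d, F t ∈ Icc 0 d)
    (ha : ∀ s ∈ Icc 0 d, ∀ t ∈ Icc 0 d, s < t → F t < F s)
    (hs : ∀ u ∈ Icc 0 d, ∃ v ∈ Icc 0 d, F v = u) : ∃ c ∈ Icc 0 d, F c = c := by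
  set S : Set ℝ := {t | t ∈ Icc 0 d ∧ t ≤ F t} with hS
  have h0 : (0:ℝ) ∈ S := ⟨⟨le_rfl, hd⟩, (hF 0 ⟨le_rfl, hd⟩).1⟩
  have hb : BddAbove S := ⟨d, fun t ht => ht.1.2⟩
  set c := sSup S with hc
  have hc0 : 0 ≤ c := le_csSup hb h0
  have hcd : c ≤ d := csSup_le ⟨0, h0⟩ fun t ht => ht.1.2
  have hcm : c ∈ Icc 0 d := ⟨hc0, hcd⟩
  have ha' : ∀ s ∈ Icc 0 d, ∀ t ∈ Icc 0 d, F t < F s → s < t := by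
    intro s hs t ht h
    by_contra hn
    rcases (not_lt.1 hn).lt_or_eq with h1 | h1
    · exact absurd (ha t ht s hs h1) (by linarith)
    · rw [h1] at h; exact lt_irrefl _ h
  have hlt : ∀ t ∈ Icc 0 d, t < c → t ≤ F t := by
    intro t ht htc
    obtain ⟨t', ht', h⟩ := exists_lt_of_lt_csSup ⟨0, h0⟩ htc
    have := ha t ht t' ht'.1 h
    linarith [ht'.2]
  have hgt : ∀ t ∈ Icc 0 d, c < t → F t < t := by
    intro t ht htc
    by_contra hn
    exact absurd (le_csSup hb (show t ∈ S from ⟨ht, not_lt.1 hn⟩)) (not_le.2 htc)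
  refine ⟨c, hcm, ?_⟩
  have hFc := hF c hcm
  rcases lt_trichotomy (F c) c with h | h | h
  · exfalso
    obtain ⟨v, hv, hvu⟩ := hs ((F c + c) / 2) ⟨by linarith [hFc.1], by linarith⟩
    have h1 : v < c := ha' v hv c hcm (by linarith)
    have h2 := hlt v hv h1
    have hm : ((F c + c) / 2 + c) / 2 ∈ Icc 0 d := ⟨by linarith [hFc.1], by linarith⟩
    have h3 := hlt _ hm (by linarith)
    have h4 := ha' _ hm v hv (by linarith)
    linarith
  · exact h
  · exfalso
    obtain ⟨v, hv, hvu⟩ := hs ((F c + c) / 2) ⟨by linarith [hFc.1], by linarith [hFc.2]⟩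
    have h1 : c < v := ha' c hcm v hv (by linarith)
    have h2 := hgt v hv h1
    have hm : ((F c + c) / 2 + c) / 2 ∈ Icc 0 d := ⟨by linarith [hFc.1], by linarith [hFc.2]⟩
    have h3 := hgt _ hm (by linarith)
    have h4 := ha' v hv _ hm (by linarith)
    linarith

variable {G : Type*} [Group G] [MulAction G T]

lemma smul_bt (hT : IsRTree T) (hact : ActsByWeakHomeos G T) (g : G) {a b c : T}
    (h : Bt a b c) : Bt (g • a) (g • b) (g • c) := by
  by_cases h1 : b = a
  · subst h1; exact bt_left _ _
  by_cases h2 : b = c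
  · subst h2; exact bt_right _ _
  have := ((hact g).2 b a c).1 ⟨(mem_seg_iff hT).2 h, h1, h2⟩
  exact (mem_seg_iff hT).1 this.1

lemma nn (hT : IsRTree T) (hact : ActsByWeakHomeos G T) (hnn : NonNesting G T) (g : G) {x y : T}
    (h1 : Bt x (g • x) y) (h2 : Bt x (g • y) y) :
    Bt (g • x) x (g • y) ∧ Bt (g • x) y (g • y) := by
  have hsub : (fun t : T => g • t) '' seg x y ⊆ seg x y := by
    rintro _ ⟨p, hp, rfl⟩
    rw [mem_seg_iff hT] at hp ⊢
    have hp := smul_bt hT hact g hp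
    exact conv hT h1 h2 hp
  have hnot := hnn g x y
  have heq : (fun t : T => g • t) '' seg x y = seg x y := by
    by_contra hne
    exact hnot (hsub.ssubset_of_ne hne)
  have key : ∀ p, Bt x p y → Bt (g • x) p (g • y) := by
    intro p hp
    have := (mem_seg_iff hT).2 hp
    rw [← heq] at this
    obtain ⟨q, hq, rfl⟩ := this
    exact smul_bt hT hact g ((mem_seg_iff hT).1 hq)
  exact ⟨key x (bt_left _ _), key y (bt_right _ _)⟩

lemma fix_of_flip (hT : IsRTree T) (hact : ActsByWeakHomeos G T) (f : G) (z : T)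
    (hz : f • f • z = z) : ∃ t : T, f • t = t := by
  set d := dist z (f • z) with hd
  have hP : ∀ t : ℝ, ∃ p, t ∈ Icc 0 d → Bt z p (f • z) ∧ dist z p = t := by
    intro t
    by_cases ht : t ∈ Icc 0 d
    · obtain ⟨p, hp, h⟩ := geo hT z (f • z) ht
      exact ⟨p, fun _ => ⟨(mem_seg_iff hT).1 hp, h⟩⟩
    · exact ⟨z, fun h => absurd h ht⟩
  choose P hP using hP
  have hmem : ∀ p, Bt z p (f • z) → dist z p ∈ Icc 0 d := by
    intro p hp
    unfold Bt at hp
    exact ⟨dist_nonneg, by linarith [dist_nonneg (x := p) (y := f • z)]⟩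
  have hfm : ∀ p, Bt z p (f • z) → Bt z (f • p) (f • z) := by
    intro p hp
    have := smul_bt hT hact f hp
    rw [hz] at this; exact this.symm
  have hfm' : ∀ p, Bt z p (f • z) → Bt z (f⁻¹ • p) (f • z) := by
    intro p hp
    have := smul_bt hT hact f⁻¹ hp
    rw [inv_smul_smul, inv_smul_eq_iff.2 hz.symm] at this; exact this.symm
  obtain ⟨c, hc, hcF⟩ := fix_real (fun t => dist z (f • P t)) d dist_nonneg
    (fun t ht => hmem _ (hfm _ (hP t ht).1)) (by
      intro s hs t ht hst
      obtain ⟨s1, s2⟩ := hP s hs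
      obtain ⟨t1, t2⟩ := hP t ht
      have h1 := lin hT s1 t1 (by rw [s2, t2]; exact hst.le)
      have h2 := smul_bt hT hact f h1
      have h3 := hfm _ s1
      have h4 := hfm _ t1
      have hne : f • P s ≠ f • P t := by
        intro h
        have := smul_left_cancel f h
        rw [← s2, ← t2, this] at hst
        exact lt_irrefl _ hst
      have := dist_pos.2 hne
      have e1 := dist_comm (f • z) (f • P s)
      have e2 := dist_comm (f • z) (f • P t)
      unfold Bt at h2 h3 h4
      linarith) (by
      intro u hu
      obtain ⟨u1, u2⟩ := hP u hu
      refine ⟨dist z (f⁻¹ • P u), hmem _ (hfm' _ u1), ?_⟩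
      obtain ⟨v1, v2⟩ := hP _ (hmem _ (hfm' _ u1))
      have := uniq hT v1 (hfm' _ u1) v2
      rw [this, smul_inv_smul, u2])
  obtain ⟨c1, c2⟩ := hP c hc
  exact ⟨P c, uniq hT (hfm _ c1) c1 (by rw [hcF, c2])⟩

lemma axis_mem {h : G} {L : Set T} (hL : IsAxis h L) {z : T} (hz : z ∈ L) : h • z ∈ L := by
  rw [← hL.2]; exact ⟨z, hz, rfl⟩

lemma axis_inv {h : G} {L : Set T} (hL : IsAxis h L) : IsAxis h⁻¹ L := by
  refine ⟨hL.1, ?_⟩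
  conv_lhs => rw [← hL.2]
  rw [image_image]; simp

lemma axis_pow {h : G} {L : Set T} (hL : IsAxis h L) {z : T} (hz : z ∈ L) (n : ℕ) :
    h ^ n • z ∈ L := by
  induction n with
  | zero => simpa using hz
  | succ n ih => rw [pow_succ', mul_smul]; exact axis_mem hL ih

lemma tri (hT : IsRTree T) {L : Set T} (hL : IsLine L) {x y z : T} (hx : x ∈ L) (hy : y ∈ L)
    (hz : z ∈ L) : Bt x y z ∨ Bt y z x ∨ Bt z x y := by
  by_contra hn
  push Not at hn
  obtain ⟨n1, n2, n3⟩ := hn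
  apply hL.2.1
  refine ⟨x, y, z, ?_, union_subset (union_subset (hL.1 x hx y hy) (hL.1 y hy z hz))
    (hL.1 z hz x hx)⟩
  rintro c ⟨⟨h1, h2⟩, h3⟩
  rw [mem_seg_iff hT] at h1 h2 h3
  refine ⟨?_, ?_, ?_⟩
  · rintro rfl; exact n3 h2.symm
  · rintro rfl; exact n1 h3.symm
  · rintro rfl; exact n2 h1.symm

lemma inv_lox {h : G} (hlox : ¬ ∃ t : T, h • t = t) : ¬ ∃ t : T, h⁻¹ • t = t := by
  rintro ⟨t, ht⟩
  exact hlox ⟨t, (inv_smul_eq_iff.1 ht).symm⟩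

lemma step_aux (hT : IsRTree T) (hact : ActsByWeakHomeos G T) (hnn : NonNesting G T) {h : G}
    (hlox : ¬ ∃ t : T, h • t = t) {z : T} : ¬ Bt z (h • h • z) (h • z) := by
  intro hb
  obtain ⟨h1, h2⟩ := nn hT hact hnn h (bt_right z (h • z)) hb
  have := anti hb.symm h1
  exact hlox (fix_of_flip hT hact h z this)

lemma step (hT : IsRTree T) (hact : ActsByWeakHomeos G T) (hnn : NonNesting G T) {h : G}
    (hlox : ¬ ∃ t : T, h • t = t) {L : Set T} (hL : IsAxis h L) {z : T} (hz : z ∈ L) :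
    Bt z (h • z) (h • h • z) := by
  rcases tri hT hL.1 hz (axis_mem hL hz) (axis_mem hL (axis_mem hL hz)) with h1 | h1 | h1
  · exact h1
  · exact absurd h1.symm (step_aux hT hact hnn hlox)
  · exfalso
    have := step_aux hT hact hnn (inv_lox hlox) (z := h • h • z)
    rw [inv_smul_smul, inv_smul_smul] at this
    exact this h1

lemma chain1 (hT : IsRTree T) (hact : ActsByWeakHomeos G T) {h : G}
    (hlox : ¬ ∃ t : T, h • t = t) {z : T} (hz : Bt z (h • z) (h • h • z)) (n : ℕ) :
    Bt z (h ^ n • z) (h ^ (n + 1) • z) := by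
  induction n with
  | zero => simp [bt_left]
  | succ n ih =>
    have h1 := smul_bt hT hact (h ^ n) hz
    have e1 : h ^ n • h • z = h ^ (n + 1) • z := by rw [pow_succ, mul_smul]
    have e2 : h ^ n • h • h • z = h ^ (n + 1 + 1) • z := by rw [pow_succ, pow_succ, mul_smul, mul_smul]
    rw [e1, e2] at h1
    refine (concat hT ih h1 ?_).2
    rw [← e1]
    intro he
    exact hlox ⟨z, (smul_left_cancel _ he).symm⟩

lemma chain (hT : IsRTree T) (hact : ActsByWeakHomeos G T) {h : G}
    (hlox : ¬ ∃ t : T, h • t = t) {z : T} (hz : Bt z (h • z) (h • h • z)) (i k : ℕ) :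
    Bt z (h ^ i • z) (h ^ (i + k) • z) := by
  induction k with
  | zero => exact bt_right _ _
  | succ k ih => exact ih.tr1 (chain1 hT hact hlox hz (i + k))

open Filter Topology in
lemma escape (hT : IsRTree T) (hact : ActsByWeakHomeos G T) {h : G}
    (hlox : ¬ ∃ t : T, h • t = t) {z : T} (hz : Bt z (h • z) (h • h • z)) (w : T) :
    ∃ n : ℕ, ¬ Bt z (h ^ n • z) w := by
  by_contra hn
  push Not at hn
  set u : ℕ → T := fun n => h ^ n • z with hu
  have hmono : Monotone fun n => dist z (u n) := by
    apply monotone_nat_of_le_succ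
    intro n
    have := chain1 hT hact hlox hz n
    unfold Bt at this
    simp only [hu]
    linarith [dist_nonneg (x := h ^ n • z) (y := h ^ (n + 1) • z)]
  have hbdd : BddAbove (range fun n => dist z (u n)) := by
    refine ⟨dist z w, ?_⟩
    rintro _ ⟨n, rfl⟩
    have := hn n
    unfold Bt at this
    simp only [hu]
    linarith [dist_nonneg (x := h ^ n • z) (y := w)]
  have hlim := tendsto_atTop_ciSup hmono hbdd
  set t := ⨆ n, dist z (u n) with ht
  have hle : ∀ n, dist z (u n) ≤ t := fun n => le_ciSup hbdd n
  have htw : t ≤ dist z w := by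
    apply ciSup_le
    intro n
    have := hn n
    unfold Bt at this
    simp only [hu]
    linarith [dist_nonneg (x := h ^ n • z) (y := w)]
  obtain ⟨s, hs, hst⟩ := geo hT z w (t := t) ⟨le_trans dist_nonneg (hle 0), htw⟩
  rw [mem_seg_iff hT] at hs
  have hbs : ∀ n, Bt z (u n) s := fun n => lin hT (hn n) hs (by rw [hst]; exact hle n)
  have hus : Tendsto u atTop (𝓝 s) := by
    rw [tendsto_iff_dist_tendsto_zero]
    have : (fun n => dist (u n) s) = fun n => t - dist z (u n) := by
      funext n
      have := hbs n
      unfold Bt at this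
      linarith
    rw [this]
    simpa using hlim.const_sub t
  have hclosed : ∀ a b : T, (∀ n, Bt a (u n) b) → Bt a s b := by
    intro a b hab
    have h1 : Tendsto (fun n => dist a (u n) + dist (u n) b) atTop (𝓝 (dist a s + dist s b)) :=
      (tendsto_const_nhds.dist hus).add (hus.dist tendsto_const_nhds)
    have h2 : (fun n => dist a (u n) + dist (u n) b) = fun _ => dist a b := funext hab
    rw [h2] at h1
    exact tendsto_nhds_unique h1 tendsto_const_nhds
  have hsucc : ∀ n, h • u n = u (n + 1) := by
    intro n; simp only [hu]; rw [pow_succ', mul_smul]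
  have hu0 : u 0 = z := by simp [hu]
  have hz1 : h • z = u 1 := by simp [hu]
  -- first
  have A : Bt (h • z) s (h • s) := by
    have hus' : ∀ n, Bt (h • z) (u (n + 1)) (h • s) := by
      intro n
      rw [← hsucc]; exact smul_bt hT hact h (hbs n)
    have hus1 := hus.comp (tendsto_add_atTop_nat 1)
    have h1 : Tendsto (fun n => dist (h • z) (u (n+1)) + dist (u (n+1)) (h • s)) atTop
        (𝓝 (dist (h • z) s + dist s (h • s))) :=
      (tendsto_const_nhds.dist hus1).add (hus1.dist tendsto_const_nhds)
    have h2 : (fun n => dist (h • z) (u (n+1)) + dist (u (n+1)) (h • s))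
      = fun _ => dist (h • z) (h • s) := funext hus'
    rw [h2] at h1
    exact tendsto_nhds_unique h1 tendsto_const_nhds
  have B : Bt z s (h⁻¹ • s) := by
    apply hclosed
    intro n
    have h1 : Bt z (u 1) (u (n + 1)) := by
      have := chain hT hact hlox hz 1 n
      rwa [add_comm] at this
    have h2 := smul_bt hT hact h⁻¹ (h1.tr2 (hbs (n + 1)))
    rwa [← hz1, inv_smul_smul, ← hsucc n, inv_smul_smul] at h2
  have C := smul_bt hT hact h B
  rw [smul_inv_smul] at C
  exact hlox ⟨s, (anti A C).symm⟩

lemma gate (hT : IsRTree T) (hact : ActsByWeakHomeos G T) (hnn : NonNesting G T) {h : G}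
    (hlox : ¬ ∃ t : T, h • t = t) {L : Set T} (hL : IsAxis h L) {z : T} (hz : z ∈ L) (x : T) :
    ∃ y ∈ L, (∀ l ∈ L, Bt x y l) ∧ ∃ n m : ℕ, Bt (h⁻¹ ^ n • z) y (h ^ m • z) := by
  obtain ⟨m, hm⟩ := escape hT hact hlox (step hT hact hnn hlox hL hz) x
  obtain ⟨n, hn⟩ := escape hT hact (inv_lox hlox)
    (step hT hact hnn (inv_lox hlox) (axis_inv hL) hz) x
  have ha : h⁻¹ ^ n • z ∈ L := axis_pow (axis_inv hL) hz n
  have hb : h ^ m • z ∈ L := axis_pow hL hz m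
  have hazb : Bt (h⁻¹ ^ n • z) z (h ^ m • z) := by
    have := smul_bt hT hact (h⁻¹ ^ n) (chain hT hact hlox (step hT hact hnn hlox hL hz) n m)
    rwa [pow_add, mul_smul, inv_pow, inv_smul_smul, inv_smul_smul, ← inv_pow] at this
  set a := h⁻¹ ^ n • z
  set b := h ^ m • z
  obtain ⟨y, h1, h2, h3⟩ := median hT x a b
  have hyL : y ∈ L := hL.1.1 a ha b hb ((mem_seg_iff hT).2 h3)
  have hyb : y ≠ b := by
    rintro rfl
    exact hm (hazb.tr2 h1.symm)
  have hya : y ≠ a := by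
    rintro rfl
    exact hn (hazb.symm.tr2 h2.symm)
  refine ⟨y, hyL, ?_, n, m, h3⟩
  intro l hl
  rcases tri hT hL.1 ha hl hb with h4 | h4 | h4
  · rcases split hT y h4 with h5 | h5
    · exact (h5.tr2 h1.symm).symm
    · exact (h5.symm.tr2 h2.symm).symm
  · exact (concat hT h2 (h3.tr2 h4.symm) hyb).1
  · exact (concat hT h1 (h3.symm.tr2 h4) hya).1

/-- The segment from `x` to `H x` passes through the gates. -/
lemma gate_pass (hT : IsRTree T) (hact : ActsByWeakHomeos G T) {H : G} {L : Set T}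
    (h1 : ∀ l ∈ L, H • l ∈ L) (h2 : ∀ l ∈ L, H⁻¹ • l ∈ L) {x y : T} (hy : y ∈ L)
    (hg : ∀ l ∈ L, Bt x y l) : Bt x y (H • y) ∧ Bt y (H • y) (H • x) := by
  refine ⟨hg _ (h1 y hy), ?_⟩
  have := smul_bt hT hact H (hg _ (h2 y hy))
  rw [smul_inv_smul] at this
  exact this.symm

lemma mem_axis (hT : IsRTree T) (hact : ActsByWeakHomeos G T) (hnn : NonNesting G T) {h : G}
    (hlox : ¬ ∃ t : T, h • t = t) {L : Set T} (hL : IsAxis h L) {z : T} (hz : z ∈ L) {w : T}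
    (hw : Bt w (h • w) (h • h • w)) : w ∈ L := by
  obtain ⟨y, hy, hg, -⟩ := gate hT hact hnn hlox hL hz w
  obtain ⟨p1, p2⟩ := gate_pass hT hact (H := h) (fun l hl => axis_mem hL hl)
    (fun l hl => axis_mem (axis_inv hL) hl) hy hg
  have hne : y ≠ h • y := fun he => hlox ⟨y, he.symm⟩
  obtain ⟨q1, q2⟩ := concat hT p1 p2 hne
  have r1 := smul_bt hT hact h q1
  have r2 := q2.tr2 hw
  have := anti r1.symm r2.symm
  rw [← smul_left_cancel h this]
  exact hy

lemma locate_aux (hT : IsRTree T) {h : G} {z w : T} (N : ℕ) (hw : Bt z w (h ^ N • z)) :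
    ∃ k : ℕ, Bt (h ^ k • z) w (h ^ k • h • z) := by
  induction N with
  | zero =>
    refine ⟨0, ?_⟩
    simp only [pow_zero, one_smul] at *
    have : z = w := anti (bt_left z w) hw
    rw [this]; exact bt_left _ _
  | succ N ih =>
    rcases split hT (h ^ N • z) hw with h1 | h1
    · exact ih h1
    · exact ⟨N, by rwa [pow_succ, mul_smul] at h1⟩

lemma locate (hT : IsRTree T) (hact : ActsByWeakHomeos G T) (hnn : NonNesting G T) {h : G}
    (hlox : ¬ ∃ t : T, h • t = t) {L : Set T} (hL : IsAxis h L) {z w : T} (hz : z ∈ L)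
    (hw : w ∈ L) : ∃ v : G, Commute v h ∧ Bt (v • z) w (h • v • z) ∧ v • z ∈ L := by
  obtain ⟨y, hy, hg, n, m, hnm⟩ := gate hT hact hnn hlox hL hz w
  have : y = w := by
    have := hg w hw
    unfold Bt at this
    rw [dist_self, dist_comm y w] at this
    exact (dist_eq_zero.1 (by linarith [dist_nonneg (x := w) (y := y)])).symm
  subst this
  obtain ⟨k, hk⟩ := locate_aux (h := h) (z := h⁻¹ ^ n • z) (w := y) hT (n + m) (by
    rwa [add_comm, pow_add, mul_smul, inv_pow, smul_inv_smul, ← inv_pow])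
  have hc : Commute (h ^ k * h⁻¹ ^ n) h :=
    ((Commute.refl h).pow_left k).mul_left ((Commute.refl h).inv_left.pow_left n)
  refine ⟨h ^ k * h⁻¹ ^ n, hc, ?_, ?_⟩
  · rw [← mul_smul h, ← hc.eq]
    simp only [mul_smul] at *
    have e : h⁻¹ ^ n • h • z = h • h⁻¹ ^ n • z := by
      rw [← mul_smul, ← mul_smul, ((Commute.refl h).inv_left.pow_left n).eq]
    rw [e]; exact hk
  · rw [mul_smul]; exact axis_pow hL (axis_pow (axis_inv hL) hz n) k

lemma main (hT : IsRTree T) (hact : ActsByWeakHomeos G T) (hnn : NonNesting G T) {h : G}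
    (hlox : ¬ ∃ t : T, h • t = t) {L : Set T} (hL : IsAxis h L) {y w : T} (hy : y ∈ L)
    (hw : Bt w (h • w) (h • h • w)) (q : G)
    (h1 : Bt w (q • y) (h • w)) (h2 : Bt w (q • h • h • y) (h • w)) : False := by
  have hwL := mem_axis hT hact hnn hlox hL hy hw
  obtain ⟨v, hv, hb, hzL⟩ := locate hT hact hnn hlox hL hy hwL
  set z := v • y with hz
  have e1 : (q * v⁻¹) • z = q • y := by rw [hz, mul_smul, inv_smul_smul]
  have e2 : (q * v⁻¹) • h • h • z = q • h • h • y := by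
    have : h • h • z = v • h • h • y := by
      rw [hz]
      simp only [← mul_smul]
      congr 1
      rw [← mul_assoc v, hv.eq, mul_assoc h v, hv.eq]
    rw [this, mul_smul, inv_smul_smul]
  rw [← e1] at h1
  rw [← e2] at h2
  have hb2 := smul_bt hT hact h hb
  have hst := step hT hact hnn hlox hL hzL
  have m1 : Bt z w (h • h • z) := hb.tr1 hst
  have m2 : Bt z (h • w) (h • h • z) := (hb2.symm.tr1 hst.symm).symm
  obtain ⟨n1, n2⟩ := nn hT hact hnn (q * v⁻¹) (conv hT m1 m2 h1) (conv hT m1 m2 h2)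
  have d1 := dist_le_of_bt n1 n2
  have d2 := dist_le_of_bt h1 h2
  have d3 := dist_triangle w (h • z) (h • w)
  unfold Bt at hb hb2 hst
  have d4 := dist_nonneg (x := z) (y := w)
  have d5 := dist_nonneg (x := h • w) (y := h • h • z)
  have e3 : z = w := dist_eq_zero.1 (by linarith)
  have e4 : h • w = h • h • z := dist_eq_zero.1 (by linarith)
  rw [e3] at e4
  exact hlox ⟨h • w, e4.symm⟩

lemma main' (hT : IsRTree T) (hact : ActsByWeakHomeos G T) (hnn : NonNesting G T) {h η : G}
    (hη : η = h ∨ η = h⁻¹)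
    (hlox : ¬ ∃ t : T, h • t = t) {L : Set T} (hL : IsAxis h L) {y w : T} (hy : y ∈ L)
    (hw : Bt w (h • w) (h • h • w)) (q : G)
    (h1 : Bt w (q • y) (h • w)) (h2 : Bt w (q • η ^ 2 • y) (h • w)) : False := by
  rw [pow_two, mul_smul] at h2
  rcases hη with rfl | rfl
  · exact main hT hact hnn hlox hL hy hw q h1 h2
  · refine main hT hact hnn hlox hL
      (axis_mem (axis_inv hL) (axis_mem (axis_inv hL) hy)) hw q h2 ?_
    rwa [smul_inv_smul, smul_inv_smul]

lemma final (hT : IsRTree T) (hact : ActsByWeakHomeos G T) (hnn : NonNesting G T) {h η k p : G}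
    (hη : η = h ∨ η = h⁻¹) (hlox : ¬ ∃ t : T, h • t = t)
    (hlox2 : ¬ ∃ t : T, (k * h * k⁻¹) • t = t) {L L₂ : Set T} (hL : IsAxis h L)
    (hL₂ : IsAxis (k * h * k⁻¹) L₂) (hg : (k * h * k⁻¹) * h = p * η ^ 6 * p⁻¹)
    {b : T} (hb : b ∈ L) (hb2 : b ∈ L₂) : False := by
  have hηlox : ¬ ∃ t : T, η • t = t := by
    rcases hη with rfl | rfl
    · exact hlox
    · exact inv_lox hlox
  have hηL : IsAxis η L := by
    rcases hη with rfl | rfl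
    · exact hL
    · exact axis_inv hL
  have hxL : h⁻¹ • b ∈ L := axis_mem (axis_inv hL) hb
  have hxb : h • h⁻¹ • b = b := smul_inv_smul _ _
  set x := h⁻¹ • b with hx
  have hsx := step hT hact hnn hlox hL hxL
  obtain ⟨y, hy, hgate, -⟩ := gate hT hact hnn hηlox hηL hb (p⁻¹ • x)
  have hsy := step hT hact hnn hηlox hηL hy
  obtain ⟨a1, a2⟩ := gate_pass hT hact (H := η ^ 6) (fun l hl => axis_pow hηL hl 6)
    (fun l hl => by rw [← inv_pow]; exact axis_pow (axis_inv hηL) hl 6) hy hgate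
  have c1 : Bt y (η ^ 1 • y) (η ^ 6 • y) := chain hT hact hηlox hsy 1 5
  have c2 : Bt y (η ^ 2 • y) (η ^ 3 • y) := chain hT hact hηlox hsy 2 1
  have c3 : Bt y (η ^ 3 • y) (η ^ 6 • y) := chain hT hact hηlox hsy 3 3
  have c4 := smul_bt hT hact (η ^ 3) c2
  have e6 : η ^ 3 • η ^ 3 • y = η ^ 6 • y := by rw [← mul_smul, ← pow_add]
  rw [e6] at c4
  have hne : y ≠ η ^ 6 • y := by
    intro he
    rw [← he, pow_one] at c1
    have := anti c1 (bt_left y (η • y))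
    exact hηlox ⟨y, this⟩
  obtain ⟨q1, q2⟩ := concat hT a1 a2 hne
  have m3 := conv hT q1 q2 c3
  have egx : p • η ^ 6 • p⁻¹ • x = (k * h * k⁻¹) • b := by
    rw [← mul_smul, ← mul_smul, ← hg, mul_smul, hxb]
  have M3 := smul_bt hT hact p m3
  rw [egx, smul_inv_smul] at M3
  rcases split hT b M3 with hc | hc
  · have f1 : Bt (p⁻¹ • x) y (η ^ 3 • y) := (c3.symm.tr2 a1.symm).symm
    have f2 : Bt (p⁻¹ • x) (η ^ 2 • y) (η ^ 3 • y) := (c2.symm.tr1 f1.symm).symm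
    have f1 := smul_bt hT hact p f1
    have f2 := smul_bt hT hact p f2
    rw [smul_inv_smul] at f1 f2
    exact main' hT hact hnn hη hlox hL hy hsx p (by rw [hxb]; exact f1.tr1 hc)
      (by rw [hxb]; exact f2.tr1 hc)
  · have f1 := smul_bt hT hact p (c4.tr1 (c3.tr2 a2))
    rw [egx] at f1
    have f2 := (f1.symm.tr1 hc.symm).symm
    have hs2 := step hT hact hnn hlox2 hL₂ hb2
    have g1 := smul_bt hT hact k⁻¹ hs2
    have g2 := smul_bt hT hact k⁻¹ hc
    have g3 := smul_bt hT hact k⁻¹ f2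
    simp only [mul_smul, inv_smul_smul] at g1 g2 g3
    refine main' hT hact hnn hη hlox hL (axis_pow hηL hy 3) g1 (k⁻¹ * p) ?_ ?_
    · rw [mul_smul]; exact g2
    · rw [mul_smul]
      have e : η ^ 2 • η ^ 3 • y = η ^ 3 • η ^ 2 • y := by
        rw [← mul_smul, ← mul_smul, ← pow_add, ← pow_add]
      rw [e]; exact g3

end tree
end AxD

/-- For a non-nesting action by weak homeomorphisms on an `ℝ`-tree,
if `h₁, h₂` are loxodromic and conjugate, and `g = h₂ * h₁` is conjugate to `h₁⁶`
or to `h₁⁻⁶`, then the axes of `h₁` and `h₂` are disjoint. -/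
theorem axes_disjoint
    {T : Type*} [MetricSpace T] (hT : IsRTree T)
    {G : Type*} [Group G] [MulAction G T]
    (hact : ActsByWeakHomeos G T) (hnn : NonNesting G T)
    (h₁ h₂ : G) (hlox₁ : ¬ ∃ t : T, h₁ • t = t) (hlox₂ : ¬ ∃ t : T, h₂ • t = t)
    (hconj : IsConj h₁ h₂) (g : G) (hgdef : g = h₂ * h₁)
    (hgconj : IsConj g (h₁ ^ 6) ∨ IsConj g (h₁⁻¹ ^ 6))
    (L₁ L₂ : Set T) (hL₁ : IsAxis h₁ L₁) (hL₂ : IsAxis h₂ L₂) :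
    L₁ ∩ L₂ = ∅ := by
  rw [eq_empty_iff_forall_notMem]
  rintro b ⟨hb1, hb2⟩
  obtain ⟨k, rfl⟩ := isConj_iff.1 hconj
  subst hgdef
  have : ∃ η p : G, (η = h₁ ∨ η = h₁⁻¹) ∧ (k * h₁ * k⁻¹) * h₁ = p * η ^ 6 * p⁻¹ := by
    rcases hgconj with h | h
    · obtain ⟨c, hc⟩ := isConj_iff.1 h.symm
      exact ⟨h₁, c, Or.inl rfl, hc.symm⟩
    · obtain ⟨c, hc⟩ := isConj_iff.1 h.symm
      exact ⟨h₁⁻¹, c, Or.inr rfl, hc.symm⟩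
  obtain ⟨η, p, hη, hg⟩ := this
  exact AxD.final hT hact hnn hη hlox₁ hlox₂ hL₁ hL₂ hg hb1 hb2
end

section
/- Let T be an ℝ-tree and let G be a group with a non-nesting action on T by weak homeomorphisms. Suppose h₁, h₂ ∈ G are loxodromic and conjugate to each other, that g = h₂h₁ is conjugate to h₁⁶ or to h₁⁻⁶, and that L_{h₁} ∩ L_{h₂} = ∅. Let [a,b] be the bridge between L_{h₁} and L_{h₂} with a ∈ L_{h₁}, b ∈ L_{h₂}. Then g is loxodromic, [h₁⁻¹(a), a] ∪ [a,b] ∪ [b, h₂(b)] ⊆ L_g, and h₁⁻¹(a) < a < b < h₂(b) for the linear order on L_g preserved by g with x < g(x) for all x ∈ L_g. -/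
open Set

/-- A strict linear order on the line `L` compatible with the betweenness structure
of the tree (the segments between points of `L` are the order intervals). -/
def CompatOrder {T : Type*} [MetricSpace T] (L : Set T) (lt : T → T → Prop) : Prop :=
  (∀ x ∈ L, ¬ lt x x) ∧
  (∀ x ∈ L, ∀ y ∈ L, ∀ z ∈ L, lt x y → lt y z → lt x z) ∧
  (∀ x ∈ L, ∀ y ∈ L, x ≠ y → lt x y ∨ lt y x) ∧
  (∀ x ∈ L, ∀ y ∈ L, ∀ z ∈ L,
    (z ∈ seg x y ↔ z = x ∨ z = y ∨ (lt x z ∧ lt z y) ∨ (lt y z ∧ lt z x)))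

/-- Metric betweenness. -/
def MB {T : Type*} [MetricSpace T] (x y z : T) : Prop := dist x y + dist y z = dist x z

section Tree
variable {T : Type*} [MetricSpace T]

theorem MB.symm {x y z : T} (h : MB x y z) : MB z y x := by
  unfold MB at *
  rw [dist_comm z y, dist_comm y x, dist_comm z x]; linarith

theorem seg_eq_of_arc (hT : IsRTree T) {x y : T} (hxy : x ≠ y) {A : Set T} (hA : IsArc A x y) :
    seg x y = A := by
  unfold seg
  rw [if_neg hxy]
  obtain ⟨B, hB, hu⟩ := hT.arc_existsUnique hxy
  have : {A : Set T | IsArc A x y} = {A} := by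
    ext C
    simp only [mem_setOf_eq, mem_singleton_iff]
    constructor
    · intro hC; rw [hu C hC, hu A hA]
    · rintro rfl; exact hA
  rw [this, sInter_singleton]

/-- A continuous injective map on `[u,v]` parametrizes the segment. -/
theorem seg_eq_image (hT : IsRTree T) {u v : ℝ} (huv : u < v) (f : ℝ → T)
    (hc : ContinuousOn f (Icc u v)) (hi : InjOn f (Icc u v)) :
    seg (f u) (f v) = f '' Icc u v := by
  have hne : f u ≠ f v := fun h =>
    huv.ne (hi (left_mem_Icc.2 huv.le) (right_mem_Icc.2 huv.le) h)
  have himg : (fun t : ℝ => u + t * (v - u)) '' Icc (0:ℝ) 1 = Icc u v := by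
    ext s
    simp only [mem_image, mem_Icc]
    constructor
    · rintro ⟨t, ⟨h0, h1⟩, rfl⟩
      constructor <;> nlinarith
    · rintro ⟨h0, h1⟩
      have : 0 < v - u := by linarith
      refine ⟨(s - u) / (v - u), ⟨div_nonneg (by linarith) this.le, ?_⟩, ?_⟩
      · rw [div_le_one this]; linarith
      · field_simp; ring
  apply seg_eq_of_arc hT hne
  refine ⟨fun t => f (u + t * (v - u)), ?_, ?_, ?_, by simp, by simp⟩
  · apply ContinuousOn.comp hc (by fun_prop)
    intro t ht; rw [← himg]; exact mem_image_of_mem _ ht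
  · intro s hs t ht h
    have := hi (by rw [← himg]; exact mem_image_of_mem _ hs)
      (by rw [← himg]; exact mem_image_of_mem _ ht) h
    have h2 : (s - t) * (v - u) = 0 := by linarith
    rcases mul_eq_zero.1 h2 with h3 | h3 <;> linarith
  · rw [← himg, image_image]

/-- Geodesic parametrization of a segment. -/
theorem exists_geod (hT : IsRTree T) (x y : T) :
    ∃ f : ℝ → T, (∀ s ∈ Icc 0 (dist x y), ∀ t ∈ Icc 0 (dist x y), dist (f s) (f t) = |s - t|) ∧
      f 0 = x ∧ f (dist x y) = y ∧ f '' Icc 0 (dist x y) = seg x y := by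
  by_cases hxy : x = y
  · subst hxy
    refine ⟨fun _ => x, ?_, rfl, rfl, ?_⟩
    · intro s hs t ht
      simp at hs ht
      simp [hs, ht]
    · simp [seg]
  obtain ⟨A, hA, -⟩ := hT.arc_existsUnique hxy
  obtain ⟨a, b, f, hab, hf, himg⟩ := hT.arc_isometric hxy A hA
  have hx : x ∈ f '' Icc a b := by
    obtain ⟨φ, -, -, h, h0, h1⟩ := hA
    rw [himg, ← h, ← h0]; exact mem_image_of_mem _ (by simp)
  have hy : y ∈ f '' Icc a b := by
    obtain ⟨φ, -, -, h, h0, h1⟩ := hA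
    rw [himg, ← h, ← h1]; exact mem_image_of_mem _ (by simp)
  obtain ⟨s, hs, rfl⟩ := hx
  obtain ⟨t, ht, rfl⟩ := hy
  have hD : dist (f s) (f t) = |s - t| := hf s hs t ht
  have key : ∃ F : ℝ → T, (∀ u ∈ Icc 0 (dist (f s) (f t)), ∀ v ∈ Icc 0 (dist (f s) (f t)),
      dist (F u) (F v) = |u - v|) ∧ F 0 = f s ∧ F (dist (f s) (f t)) = f t := by
    rw [hD]
    simp only [mem_Icc] at *
    rcases le_total s t with h | h
    · rw [abs_of_nonpos (by linarith)]
      refine ⟨fun u => f (s + u), ?_, by simp, by simp⟩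
      intro u hu v hv
      rw [hf _ ⟨by linarith, by linarith⟩ _ ⟨by linarith, by linarith⟩]
      congr 1; ring
    · rw [abs_of_nonneg (by linarith)]
      refine ⟨fun u => f (s - u), ?_, by simp, by simp⟩
      intro u hu v hv
      rw [hf _ ⟨by linarith, by linarith⟩ _ ⟨by linarith, by linarith⟩, abs_sub_comm u v]
      congr 1; ring
  obtain ⟨F, hF, h0, h1⟩ := key
  refine ⟨F, hF, h0, h1, ?_⟩
  have := seg_eq_image hT (dist_pos.2 hxy) F ?_ ?_
  · rw [h0, h1] at this; exact this.symm
  · apply LipschitzOnWith.continuousOn (K := 1)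
    apply LipschitzOnWith.of_dist_le_mul
    intro u hu v hv
    rw [hF u hu v hv, Real.dist_eq]; simp
  · intro u hu v hv h
    have := hF u hu v hv
    rw [h, dist_self] at this
    have := abs_eq_zero.1 this.symm
    linarith

theorem MB_of_mem_seg (hT : IsRTree T) {x y z : T} (h : y ∈ seg x z) : MB x y z := by
  obtain ⟨f, hf, h0, h1, himg⟩ := exists_geod hT x z
  rw [← himg] at h
  obtain ⟨s, hs, rfl⟩ := h
  have hn : 0 ≤ dist x z := dist_nonneg
  have e1 := hf 0 ⟨le_rfl, hn⟩ s hs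
  have e2 := hf s hs (dist x z) ⟨hn, le_rfl⟩
  rw [h0] at e1
  rw [h1] at e2
  rw [abs_of_nonpos (by linarith [hs.1])] at e1
  rw [abs_of_nonpos (by linarith [hs.2])] at e2
  unfold MB
  linarith

theorem left_mem_seg' (hT : IsRTree T) (x y : T) : x ∈ seg x y := by
  obtain ⟨f, hf, h0, h1, himg⟩ := exists_geod hT x y
  rw [← himg]
  exact ⟨0, ⟨le_rfl, dist_nonneg⟩, h0⟩

theorem right_mem_seg' (hT : IsRTree T) (x y : T) : y ∈ seg x y := by
  obtain ⟨f, hf, h0, h1, himg⟩ := exists_geod hT x y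
  rw [← himg]
  exact ⟨dist x y, ⟨dist_nonneg, le_rfl⟩, h1⟩

theorem mem_seg_of_inter (hT : IsRTree T) {x y z : T}
    (h : ∀ w, w ∈ seg x y → w ∈ seg y z → w = y) : y ∈ seg x z := by
  by_cases hxy : x = y
  · subst hxy; exact left_mem_seg' hT _ _
  by_cases hyz : y = z
  · subst hyz; exact right_mem_seg' hT _ _
  obtain ⟨f, hf, f0, f1, fimg⟩ := exists_geod hT x y
  obtain ⟨k, hk, k0, k1, kimg⟩ := exists_geod hT y z
  set D := dist x y with hD
  set E := dist y z with hE
  have Dpos : 0 < D := dist_pos.2 hxy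
  have Epos : 0 < E := dist_pos.2 hyz
  let F : ℝ → T := fun t => if t ≤ D then f t else k (t - D)
  have hF1 : ∀ t, t ≤ D → F t = f t := fun t ht => if_pos ht
  have hF2 : ∀ t, D ≤ t → F t = k (t - D) := by
    intro t ht
    rcases ht.eq_or_lt with rfl | h
    · rw [hF1 _ le_rfl, f1, sub_self, k0]
    · exact if_neg (not_le.2 h)
  have hfc : ContinuousOn f (Icc 0 D) := by
    apply LipschitzOnWith.continuousOn (K := 1)
    apply LipschitzOnWith.of_dist_le_mul
    intro u hu v hv
    rw [hf u hu v hv, Real.dist_eq]; simp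
  have hkc : ContinuousOn (fun t => k (t - D)) (Icc D (D + E)) := by
    apply LipschitzOnWith.continuousOn (K := 1)
    apply LipschitzOnWith.of_dist_le_mul
    intro u hu v hv
    simp only [mem_Icc] at hu hv
    rw [hk _ ⟨by linarith, by linarith⟩ _ ⟨by linarith, by linarith⟩, Real.dist_eq]; simp
  have hun : Icc 0 D ∪ Icc D (D + E) = Icc 0 (D + E) :=
    Icc_union_Icc_eq_Icc Dpos.le (by linarith)
  have hFc : ContinuousOn F (Icc 0 (D + E)) := by
    rw [← hun]
    apply ContinuousOn.union_of_isClosed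
    · exact hfc.congr fun t ht => hF1 t ht.2
    · exact hkc.congr fun t ht => hF2 t ht.1
    · exact isClosed_Icc
    · exact isClosed_Icc
  have cross : ∀ s t, 0 ≤ s → s ≤ D → D ≤ t → t ≤ D + E → F s = F t → s = t := by
    intro s t h0 h1 h2 h3 he
    rw [hF1 s h1, hF2 t h2] at he
    have m1 : f s ∈ seg x y := by rw [← fimg]; exact ⟨s, ⟨h0, h1⟩, rfl⟩
    have m2 : k (t - D) ∈ seg y z := by
      rw [← kimg]; exact ⟨t - D, ⟨by linarith, by linarith⟩, rfl⟩
    have hy := h (f s) m1 (he ▸ m2)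
    have e1 := hf s ⟨h0, h1⟩ D ⟨Dpos.le, le_rfl⟩
    have e2 := hk (t - D) ⟨by linarith, by linarith⟩ 0 ⟨le_rfl, Epos.le⟩
    rw [f1, hy, dist_self] at e1
    rw [k0, ← he, hy, dist_self] at e2
    have := abs_eq_zero.1 e1.symm
    have := abs_eq_zero.1 e2.symm
    linarith
  have hFi : InjOn F (Icc 0 (D + E)) := by
    intro s hs t ht he
    rcases le_total s D with h1 | h1 <;> rcases le_total t D with h2 | h2
    · rw [hF1 s h1, hF1 t h2] at he
      have := hf s ⟨hs.1, h1⟩ t ⟨ht.1, h2⟩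
      rw [he, dist_self] at this
      have := abs_eq_zero.1 this.symm
      linarith
    · exact cross s t hs.1 h1 h2 ht.2 he
    · exact (cross t s ht.1 h2 h1 hs.2 he.symm).symm
    · rw [hF2 s h1, hF2 t h2] at he
      have := hk (s - D) ⟨by linarith, by linarith [hs.2]⟩ (t - D)
        ⟨by linarith, by linarith [ht.2]⟩
      rw [he, dist_self] at this
      have := abs_eq_zero.1 this.symm
      linarith
  have := seg_eq_image hT (by linarith : (0:ℝ) < D + E) F hFc hFi
  rw [hF1 0 Dpos.le, f0, hF2 (D + E) (by linarith), add_sub_cancel_left, k1] at this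
  rw [this]
  exact ⟨D, ⟨Dpos.le, by linarith⟩, by rw [hF1 D le_rfl, f1]⟩

theorem mem_seg_iff (hT : IsRTree T) {x y z : T} : y ∈ seg x z ↔ MB x y z := by
  refine ⟨MB_of_mem_seg hT, fun h => mem_seg_of_inter hT ?_⟩
  intro w h1 h2
  have h1 := MB_of_mem_seg hT h1
  have h2 := MB_of_mem_seg hT h2
  unfold MB at *
  have := dist_triangle x w z
  have := dist_comm y w
  have : dist w y ≤ 0 := by linarith
  exact dist_le_zero.1 this

theorem exists_median (hT : IsRTree T) (x y z : T) : ∃ c, MB x c y ∧ MB x c z ∧ MB y c z := by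
  obtain ⟨f, hf, f0, f1, fimg⟩ := exists_geod hT x y
  have hcomp : ∀ u v : T, IsCompact (seg u v) := by
    intro u v
    obtain ⟨k, hk, -, -, kimg⟩ := exists_geod hT u v
    rw [← kimg]
    apply isCompact_Icc.image_of_continuousOn
    apply LipschitzOnWith.continuousOn (K := 1)
    apply LipschitzOnWith.of_dist_le_mul
    intro s hs t ht
    rw [hk s hs t ht, Real.dist_eq]; simp
  have hK : IsCompact (seg x y ∩ seg x z) := (hcomp x y).inter (hcomp x z)
  obtain ⟨c, ⟨hc1, hc2⟩, hmax⟩ := hK.exists_isMaxOn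
    ⟨x, left_mem_seg' hT _ _, left_mem_seg' hT _ _⟩
    (f := fun t => dist x t) (by fun_prop)
  have m1 := MB_of_mem_seg hT hc1
  have m2 := MB_of_mem_seg hT hc2
  refine ⟨c, m1, m2, MB_of_mem_seg hT (mem_seg_of_inter hT ?_)⟩
  intro w h1 h2
  have h1 := MB_of_mem_seg hT h1
  have h2 := MB_of_mem_seg hT h2
  have a1 : MB x w y := by
    unfold MB at *
    have := dist_triangle x c w
    have := dist_triangle x w y
    have := dist_comm c w
    have := dist_comm w y
    have := dist_comm c y
    linarith
  have a2 : MB x w z := by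
    unfold MB at *
    have := dist_triangle x c w
    have := dist_triangle x w z
    linarith
  have := hmax ⟨(mem_seg_iff hT).2 a1, (mem_seg_iff hT).2 a2⟩
  simp only [mem_setOf_eq] at this
  unfold MB at *
  have := dist_comm c w
  have : dist w c ≤ 0 := by linarith
  exact dist_le_zero.1 this

/-- Two points of a segment are comparable. -/
theorem MB_linear (hT : IsRTree T) {x y u v : T} (hu : MB x u y) (hv : MB x v y) :
    MB x u v ∨ MB x v u := by
  obtain ⟨f, hf, f0, f1, fimg⟩ := exists_geod hT x y
  rw [← mem_seg_iff hT, ← fimg] at hu hv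
  obtain ⟨s, hs, rfl⟩ := hu
  obtain ⟨t, ht, rfl⟩ := hv
  have z0 : (0:ℝ) ∈ Icc 0 (dist x y) := ⟨le_rfl, dist_nonneg⟩
  have e1 := hf 0 z0 s hs
  have e2 := hf 0 z0 t ht
  have e3 := hf s hs t ht
  have e4 := hf t ht s hs
  rw [f0, abs_of_nonpos (by linarith [hs.1])] at e1
  rw [f0, abs_of_nonpos (by linarith [ht.1])] at e2
  unfold MB
  rcases le_total s t with h | h
  · left
    rw [abs_of_nonpos (by linarith)] at e3
    linarith
  · right
    rw [abs_of_nonpos (by linarith)] at e4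
    linarith

theorem MB.left (x y : T) : MB x x y := by simp [MB]
theorem MB.right (x y : T) : MB x y y := by simp [MB]

theorem MB.eq_of {x y z : T} (h1 : MB x y z) (h2 : MB x z y) : y = z := by
  unfold MB at *
  have := dist_comm y z
  have : dist y z ≤ 0 := by linarith [dist_nonneg (x := y) (y := z)]
  exact dist_le_zero.1 this

/-- `u ∈ [x,v]`, `v ∈ [x,w]` imply `u ∈ [x,w]`. -/
theorem MB.trans {x u v w : T} (h1 : MB x u v) (h2 : MB x v w) : MB x u w := by
  unfold MB at *
  linarith [dist_triangle x u w, dist_triangle u v w]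

/-- `u ∈ [x,v]`, `v ∈ [x,w]` imply `v ∈ [u,w]`. -/
theorem MB.trans' {x u v w : T} (h1 : MB x u v) (h2 : MB x v w) : MB u v w := by
  unfold MB at *
  linarith [dist_triangle x u w, dist_triangle u v w]

/-- `u ∈ [x,w]`, `v ∈ [u,w]` imply `v ∈ [x,w]`. -/
theorem MB.sub {x u v w : T} (h1 : MB x u w) (h2 : MB u v w) : MB x v w :=
  (h2.symm.trans h1.symm).symm

/-- `u ∈ [x,w]`, `v ∈ [u,w]` imply `u ∈ [x,v]`. -/
theorem MB.sub' {x u v w : T} (h1 : MB x u w) (h2 : MB u v w) : MB x u v :=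
  (h2.symm.trans' h1.symm).symm

/-- If `u` lies in `[p,q]` and `[p,r]` then it lies in `[p,c]`, `c` the median. -/
theorem MB.le_median (hT : IsRTree T) {p q r c u : T} (h1 : MB p c q) (h2 : MB p c r)
    (h3 : MB q c r) (u1 : MB p u q) (u2 : MB p u r) : MB p u c := by
  rcases MB_linear hT h1 u1 with h | h
  · have a := h.trans' u1
    have b := h.trans' u2
    have : c = u := by
      unfold MB at *
      have := dist_triangle q u r
      have := dist_comm q c
      have := dist_comm q u
      have : dist c u ≤ 0 := by linarith
      exact dist_le_zero.1 this
    rw [this]; exact MB.right _ _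
  · exact h

/-- Concatenation. -/
theorem MB.chain (hT : IsRTree T) {x y z w : T} (h1 : MB x y z) (h2 : MB y z w) (hne : y ≠ z) :
    MB x z w := by
  obtain ⟨c, c1, c2, c3⟩ := exists_median hT z x w
  rcases MB_linear hT c1 h1.symm with h | h
  · -- `c ∈ [z,y]`
    have : c = z := by
      unfold MB at *
      have := dist_triangle y c w
      have := dist_comm y z
      have := dist_comm y c
      have := dist_comm z c
      have : dist c z ≤ 0 := by linarith
      exact dist_le_zero.1 this
    rw [← this]; exact c3
  · -- `y ∈ [z,c]`
    have := h.trans c2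
    exact absurd ((h2.symm.eq_of this.symm).symm) hne

theorem MB.chain' (hT : IsRTree T) {x y z w : T} (h1 : MB x y z) (h2 : MB y z w) (hne : y ≠ z) :
    MB x y w :=
  (MB.chain hT h2.symm h1.symm hne.symm).symm

/-- Existence of suprema in segments. -/
theorem exists_sup (hT : IsRTree T) {p x : T} {S : Set T} (hS : S.Nonempty)
    (h : ∀ s ∈ S, MB p s x) :
    ∃ q, (∀ s ∈ S, MB p s q) ∧ ∀ r, (∀ s ∈ S, MB p s r) → MB p q r := by
  have main : ∀ x, (∀ s ∈ S, MB p s x) → ∃ q, MB p q x ∧ dist p q = sSup ((dist p) '' S) ∧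
      ∀ s ∈ S, MB p s q := by
    intro x h
    obtain ⟨f, hf, f0, f1, fimg⟩ := exists_geod hT p x
    have hub : ∀ s ∈ S, dist p s ≤ dist p x := by
      intro s hs
      have := h s hs
      unfold MB at this
      linarith [dist_nonneg (x := s) (y := x)]
    have hbdd : BddAbove ((dist p) '' S) := ⟨dist p x, by rintro _ ⟨s, hs, rfl⟩; exact hub s hs⟩
    set D := sSup ((dist p) '' S) with hD
    have hle : ∀ s ∈ S, dist p s ≤ D := fun s hs => le_csSup hbdd ⟨s, hs, rfl⟩
    have hDx : D ≤ dist p x := csSup_le (hS.image _) (by rintro _ ⟨s, hs, rfl⟩; exact hub s hs)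
    have hD0 : 0 ≤ D := by
      obtain ⟨s, hs⟩ := hS
      exact dist_nonneg.trans (hle s hs)
    have hq : MB p (f D) x := by
      rw [← mem_seg_iff hT, ← fimg]; exact ⟨D, ⟨hD0, hDx⟩, rfl⟩
    have hd : dist p (f D) = D := by
      have := hf 0 ⟨le_rfl, dist_nonneg⟩ D ⟨hD0, hDx⟩
      rw [f0, abs_of_nonpos (by linarith)] at this
      linarith
    refine ⟨f D, hq, hd, ?_⟩
    intro s hs
    rcases MB_linear hT (h s hs) hq with h1 | h1
    · exact h1
    · have h2 := hle s hs
      have : f D = s := by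
        unfold MB at h1
        have : dist (f D) s ≤ 0 := by linarith
        exact dist_le_zero.1 this
      rw [this]; exact MB.right _ _
  obtain ⟨q, q1, q2, q3⟩ := main x h
  refine ⟨q, q3, ?_⟩
  intro r hr
  obtain ⟨c, c1, c2, c3⟩ := exists_median hT p q r
  obtain ⟨q', p1, p2, p3⟩ := main c fun s hs => MB.le_median hT c1 c2 c3 (q3 s hs) (hr s hs)
  have : c = q := by
    unfold MB at c1 p1
    have : dist c q ≤ 0 := by linarith [dist_nonneg (x := q') (y := c)]
    exact dist_le_zero.1 this
  rw [← this]; exact c2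

end Tree

section Action
variable {T : Type*} [MetricSpace T] {G : Type*} [Group G] [MulAction G T]

theorem MB.smul (hT : IsRTree T) (hact : ActsByWeakHomeos G T) (g : G) {x y z : T}
    (h : MB x y z) : MB (g • x) (g • y) (g • z) := by
  by_cases h1 : y = x
  · subst h1; exact MB.left _ _
  by_cases h2 : y = z
  · subst h2; exact MB.right _ _
  have := ((hact g).2 y x z).1 ⟨(mem_seg_iff hT).2 h, h1, h2⟩
  exact MB_of_mem_seg hT this.1

theorem MB.of_smul (hT : IsRTree T) (hact : ActsByWeakHomeos G T) (g : G) {x y z : T}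
    (h : MB (g • x) (g • y) (g • z)) : MB x y z := by
  simpa using h.smul hT hact g⁻¹

theorem image_seg (hT : IsRTree T) (hact : ActsByWeakHomeos G T) (g : G) (x y : T) :
    (fun t : T => g • t) '' seg x y = seg (g • x) (g • y) := by
  ext t
  simp only [mem_image]
  constructor
  · rintro ⟨s, hs, rfl⟩
    exact (mem_seg_iff hT).2 (((mem_seg_iff hT).1 hs).smul hT hact g)
  · intro ht
    refine ⟨g⁻¹ • t, (mem_seg_iff hT).2 ?_, by simp⟩
    apply MB.of_smul hT hact g
    simpa using (mem_seg_iff hT).1 ht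

theorem nonnest (hT : IsRTree T) (hact : ActsByWeakHomeos G T) (hnn : NonNesting G T) (g : G)
    {x y : T} (h1 : MB x (g • x) y) (h2 : MB (g • x) (g • y) y) : MB (g • x) x (g • y) := by
  by_contra hcon
  apply hnn g x y
  rw [image_seg hT hact]
  refine ⟨?_, ?_⟩
  · intro t ht
    rw [mem_seg_iff hT] at *
    exact h1.sub (ht.trans h2)
  · intro h
    exact hcon ((mem_seg_iff hT).1 (h (left_mem_seg' hT x y)))

theorem no_escape (hT : IsRTree T) (hact : ActsByWeakHomeos G T) (g : G)
    (hlox : ¬ ∃ t : T, g • t = t) {p x : T} (hp : MB p (g • p) (g • g • p))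
    (h : ∀ n : ℕ, MB p (g ^ n • p) x) : False := by
  obtain ⟨q, q1, q2⟩ := exists_sup hT (S := range fun n : ℕ => g ^ n • p) (range_nonempty _)
    (by rintro _ ⟨n, rfl⟩; exact h n)
  replace q1 : ∀ n : ℕ, MB p (g ^ n • p) q := fun n => q1 _ ⟨n, rfl⟩
  replace q2 : ∀ r, (∀ n : ℕ, MB p (g ^ n • p) r) → MB p q r :=
    fun r hr => q2 r (by rintro _ ⟨n, rfl⟩; exact hr n)
  have hgp : g • p ≠ g • g • p := fun e => hlox ⟨g • p, e.symm⟩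
  have q1' : MB p (g • p) q := by simpa using q1 1
  have a1 : MB p (g • p) (g • q) := by
    have h2 : MB (g • p) (g • g • p) (g • q) := q1'.smul hT hact g
    exact hp.chain' hT h2 hgp
  have b1 : MB p q (g • q) := by
    apply q2
    intro n
    cases n with
    | zero => simpa using MB.left p (g • q)
    | succ n =>
      have := (q1 n).smul hT hact g
      rw [smul_smul, ← pow_succ'] at this
      exact a1.sub this
  have b2 : MB p q (g⁻¹ • q) := by
    apply q2
    intro n
    apply MB.of_smul hT hact g
    rw [smul_smul, ← pow_succ', smul_inv_smul]
    have h1 := q1 (n + 1)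
    have h3 : MB p (g • p) (g ^ (n + 1) • p) := by
      rcases MB_linear hT q1' h1 with h | h
      · exact h
      · induction n with
        | zero => simpa using MB.right p (g • p)
        | succ n ih =>
          have ih' : MB p (g • p) (g ^ (n + 1) • p) := by
            rcases MB_linear hT q1' (q1 (n + 1)) with h | h
            · exact h
            · exact ih (q1 (n + 1)) h
          -- `g^(n+1) p ∈ [gp, q]`, so `g^(n+2)p ∈ [ggp, gq]`
          have k1 : MB (g • p) (g • g • p) (g ^ (n + 2) • p) := by
            have := ih'.smul hT hact g
            rwa [smul_smul g (g ^ (n + 1)), ← pow_succ'] at this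
          exact hp.chain' hT k1 hgp
    exact h3.trans' h1
  have b3 := b2.smul hT hact g
  rw [smul_inv_smul] at b3
  exact hlox ⟨q, (b1.eq_of (q1'.sub b3)).symm⟩

theorem axis_nat (hT : IsRTree T) (hact : ActsByWeakHomeos G T) (g : G)
    (hlox : ¬ ∃ t : T, g • t = t) {p : T} (hp : MB p (g • p) (g • g • p)) (n m : ℕ) :
    MB p (g ^ n • p) (g ^ (n + m) • p) := by
  have step : ∀ n : ℕ, MB p (g ^ n • p) (g ^ (n + 1) • p) := by
    intro n
    induction n with
    | zero => simpa using MB.left p (g • p)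
    | succ n ih =>
      have k := hp.smul hT hact (g ^ n)
      simp only [smul_smul, ← pow_succ] at k
      rw [← mul_assoc, ← pow_succ, ← pow_succ] at k
      refine ih.chain hT k ?_
      intro e
      apply hlox
      refine ⟨g ^ n • p, ?_⟩
      rw [smul_smul, ← pow_succ', ← e]
  induction m with
  | zero => exact MB.right _ _
  | succ m ih => exact ih.trans (step (n + m))

theorem axis_int (hT : IsRTree T) (hact : ActsByWeakHomeos G T) (g : G)
    (hlox : ¬ ∃ t : T, g • t = t) {p : T} (hp : MB p (g • p) (g • g • p)) {i j k : ℤ}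
    (hij : i ≤ j) (hjk : j ≤ k) :
    MB (g ^ i • p) (g ^ j • p) (g ^ k • p) := by
  obtain ⟨n, rfl⟩ := Int.le.dest hij
  obtain ⟨m, rfl⟩ := Int.le.dest hjk
  have := (axis_nat hT hact g hlox hp n m).smul hT hact (g ^ i)
  simp only [smul_smul] at this
  rw [← zpow_natCast, ← zpow_natCast, ← zpow_add, ← zpow_add] at this
  simpa [add_assoc] using this

theorem proj_aux (hT : IsRTree T) (hact : ActsByWeakHomeos G T) (hnn : NonNesting G T) (g : G)
    {u v c x : T} (h1 : MB u c v) (h2 : MB v c x) (hcv : c ≠ v) (h3 : MB u (g • u) (g • v))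
    (h4 : MB u v (g • v)) (hu : g • u ≠ u) : MB x c (g • c) := by
  have e1 : MB (g • u) (g • c) (g • v) := h1.smul hT hact g
  have e2 : MB u (g • c) (g • v) := h3.sub e1
  have e3 : MB u c (g • v) := h1.trans h4
  have e4 : MB u c (g • c) := by
    rcases MB_linear hT e3 e2 with h | h
    · exact h
    · exfalso
      have f1 : MB u (g • u) (g • c) := h3.sub' e1
      have f2 := nonnest hT hact hnn g (f1.trans h) (f1.trans' h)
      have f3 := f2.symm.eq_of f1.symm
      exact hu f3.symm
  have e5 : MB c v (g • v) := h1.trans' h4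
  have e6 : MB c (g • c) (g • v) := e4.trans' e2
  rcases MB_linear hT e5 e6 with h | h
  · exact h2.symm.chain' hT h hcv
  · exact h2.symm.sub' h

theorem proj_main (hT : IsRTree T) (hact : ActsByWeakHomeos G T) (hnn : NonNesting G T) (g : G)
    (hlox : ¬ ∃ t : T, g • t = t) {p : T} (hp : MB p (g • p) (g • g • p)) (x : T) :
    ∃ c, MB x c (g • x) ∧ ∃ m n : ℕ, MB (g ^ (-(m:ℤ)) • p) c (g ^ (n:ℤ) • p) := by
  have hlox' : ¬ ∃ t : T, g⁻¹ • t = t := by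
    rintro ⟨t, ht⟩
    exact hlox ⟨t, by rw [← ht, smul_inv_smul, ht]⟩
  have hp' : MB p (g⁻¹ • p) (g⁻¹ • g⁻¹ • p) := by
    have := (hp.smul hT hact (g⁻¹ * g⁻¹)).symm
    simpa [mul_smul] using this
  have n1 : ∃ n : ℕ, ¬ MB p (g ^ (n:ℤ) • p) x := by
    by_contra! hc
    exact no_escape hT hact g hlox hp fun n => by simpa using hc n
  have m1 : ∃ m : ℕ, ¬ MB p (g ^ (-(m:ℤ)) • p) x := by
    by_contra! hc
    exact no_escape hT hact g⁻¹ hlox' hp' fun n => by simpa using hc n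
  obtain ⟨n, hn⟩ := n1
  obtain ⟨m, hm⟩ := m1
  have act1 : ∀ i : ℤ, g • g ^ i • p = g ^ (i + 1) • p := by
    intro i; rw [smul_smul, add_comm, zpow_add, zpow_one]
  have act2 : ∀ i : ℤ, g⁻¹ • g ^ i • p = g ^ (i - 1) • p := by
    intro i; rw [smul_smul, sub_eq_neg_add, zpow_add, zpow_neg_one]
  have ax : ∀ {i j k : ℤ}, i ≤ j → j ≤ k → MB (g ^ i • p) (g ^ j • p) (g ^ k • p) :=
    fun h h' => axis_int hT hact g hlox hp h h'
  have hupv : MB (g ^ (-(m:ℤ)) • p) p (g ^ (n:ℤ) • p) := by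
    simpa using ax (i := -(m:ℤ)) (j := 0) (k := n) (by omega) (by omega)
  obtain ⟨c, c1, c2, c3⟩ := exists_median hT (g ^ (-(m:ℤ)) • p) (g ^ (n:ℤ) • p) x
  have hcv : c ≠ g ^ (n:ℤ) • p := by
    rintro rfl
    exact hn (hupv.trans' c2)
  have hcu : c ≠ g ^ (-(m:ℤ)) • p := by
    rintro rfl
    exact hm (hupv.symm.trans' c3)
  refine ⟨c, ?_, m, n, c1⟩
  have r1 : MB x c (g • c) := by
    refine proj_aux hT hact hnn g c1 c3 hcv ?_ ?_ fun e => hlox ⟨_, e⟩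
    · rw [act1, act1]; exact ax (by omega) (by omega)
    · rw [act1]; exact ax (by omega) (by omega)
  have r2 : MB x c (g⁻¹ • c) := by
    refine proj_aux hT hact hnn g⁻¹ c1.symm c2 hcu ?_ ?_ fun e => hlox' ⟨_, e⟩
    · rw [act2, act2]; exact (ax (by omega) (by omega)).symm
    · rw [act2]; exact (ax (by omega) (by omega)).symm
  have r3 := r2.smul hT hact g
  rw [smul_inv_smul] at r3
  exact r1.chain' hT r3.symm fun e => hlox ⟨c, e.symm⟩

theorem lox_of_aligned (hT : IsRTree T) (hact : ActsByWeakHomeos G T) (hnn : NonNesting G T)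
    (g : G) {p : T} (hp : MB p (g • p) (g • g • p)) (hne : g • p ≠ p) :
    ¬ ∃ t : T, g • t = t := by
  rintro ⟨t, ht⟩
  have ht' : g⁻¹ • t = t := by rw [inv_smul_eq_iff, ht]
  obtain ⟨m, m1, m2, m3⟩ := exists_median hT t p (g • p)
  have e : MB t (g • m) (g • p) := by
    have := m1.smul hT hact g
    rwa [ht] at this
  have fixm : g • m = m := by
    rcases MB_linear hT m2 e with h | h
    · have h' : MB t (g⁻¹ • m) m := by
        have := h.smul hT hact g⁻¹
        rwa [ht', inv_smul_smul] at this
      by_contra hcon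
      apply hnn g⁻¹ t m
      rw [image_seg hT hact, ht']
      refine ⟨fun s hs => ?_, fun hs => ?_⟩
      · rw [mem_seg_iff hT] at *
        exact hs.trans h'
      · have := (mem_seg_iff hT).1 (hs (right_mem_seg' hT t m))
        have := h'.eq_of this
        exact hcon (by rw [← this, smul_inv_smul, this])
    · by_contra hcon
      apply hnn g t m
      rw [image_seg hT hact, ht]
      refine ⟨fun s hs => ?_, fun hs => ?_⟩
      · rw [mem_seg_iff hT] at *
        exact hs.trans h
      · have := (mem_seg_iff hT).1 (hs (right_mem_seg' hT t m))
        exact hcon (h.eq_of this)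
  have k := m3.smul hT hact g
  rw [fixm] at k
  -- `m ∈ [p,gp] ∩ [gp,ggp]`
  have k2 : MB m (g • p) m := by
    have := hp.sub' k
    exact m3.trans' this
  have : m = g • p := by
    unfold MB at k2
    have := dist_comm m (g • p)
    have h0 := dist_self m
    have : dist m (g • p) ≤ 0 := by linarith
    exact dist_le_zero.1 this
  rw [this] at fixm
  have := MulAction.injective g fixm
  exact hne this

theorem line_nonempty (hT : IsRTree T) {L : Set T} (hL : IsLine L) (t : T) : L.Nonempty := by
  rw [nonempty_iff_ne_empty]
  rintro rfl
  have : ({t} : Set T) = ∅ := by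
    apply hL.2.2
    · rintro x rfl y rfl
      simp [seg]
    · rintro ⟨x, y, z, h, hs⟩
      have hx : x = t := hs (Or.inl (Or.inl (left_mem_seg' hT x y)))
      have hy : y = t := hs (Or.inl (Or.inl (right_mem_seg' hT x y)))
      have hz : z = t := hs (Or.inr (left_mem_seg' hT z x))
      subst hx hy hz
      exact (h _ ⟨⟨left_mem_seg' hT _ _, left_mem_seg' hT _ _⟩, left_mem_seg' hT _ _⟩).1 rfl
    · exact empty_subset _
  exact (singleton_ne_empty t) this

theorem mem_axis (hT : IsRTree T) (hact : ActsByWeakHomeos G T) (hnn : NonNesting G T) (g : G)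
    (hlox : ¬ ∃ t : T, g • t = t) {p : T} (hp : MB p (g • p) (g • g • p)) {L : Set T}
    (hL : IsAxis g L) : p ∈ L ∧ g • p ∈ L := by
  have inv1 : ∀ x ∈ L, g • x ∈ L := fun x hx => by
    rw [← hL.2]; exact ⟨x, hx, rfl⟩
  have inv2 : ∀ x ∈ L, g⁻¹ • x ∈ L := fun x hx => by
    rw [← hL.2] at hx
    obtain ⟨y, hy, rfl⟩ := hx
    simpa using hy
  have pow1 : ∀ n : ℕ, ∀ x ∈ L, g ^ n • x ∈ L := by
    intro n
    induction n with
    | zero => intro x hx; simpa using hx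
    | succ n ih => intro x hx; rw [pow_succ', mul_smul]; exact inv1 _ (ih x hx)
  have pow2 : ∀ n : ℕ, ∀ x ∈ L, (g⁻¹) ^ n • x ∈ L := by
    intro n
    induction n with
    | zero => intro x hx; simpa using hx
    | succ n ih => intro x hx; rw [pow_succ', mul_smul]; exact inv2 _ (ih x hx)
  obtain ⟨x, hx⟩ := line_nonempty hT hL.1 p
  obtain ⟨c, hc, m, n, hmn⟩ := proj_main hT hact hnn g hlox hp x
  have hcL : c ∈ L := hL.1.1 x hx _ (inv1 x hx) ((mem_seg_iff hT).2 hc)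
  have ax : MB (g ^ (-(m:ℤ) - n) • p) p (g ^ ((m:ℤ) + n) • p) := by
    simpa using axis_int hT hact g hlox hp (i := -(m:ℤ) - n) (j := 0) (k := m + n)
      (by omega) (by omega)
  have k1 : MB (g ^ (-(m:ℤ) - n) • p) (g⁻¹ ^ n • c) p := by
    have := hmn.smul hT hact (g ^ (-(n:ℤ)))
    rw [smul_smul, ← zpow_add, smul_smul, ← zpow_add] at this
    have e : -(n:ℤ) + -(m:ℤ) = -(m:ℤ) - n := by ring
    rw [e] at this
    simpa using this
  have k2 : MB p (g ^ m • c) (g ^ ((m:ℤ) + n) • p) := by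
    have := hmn.smul hT hact (g ^ (m:ℤ))
    rw [smul_smul, ← zpow_add, smul_smul, ← zpow_add] at this
    simpa using this
  have k3 : MB (g⁻¹ ^ n • c) p (g ^ m • c) := (k1.trans' ax).sub' k2
  have hpL : p ∈ L := hL.1.1 _ (pow2 n c hcL) _ (pow1 m c hcL) ((mem_seg_iff hT).2 k3)
  exact ⟨hpL, inv1 p hpL⟩

end Action

/-- In the situation of Statement 8, assuming moreover that the
axes `L₁, L₂` of `h₁, h₂` are disjoint with bridge `[a, b]` (`a ∈ L₁`, `b ∈ L₂`),
the element `g = h₂ * h₁` is loxodromic,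
`[h₁⁻¹ a, a] ∪ [a, b] ∪ [b, h₂ b] ⊆ L_g`, and `h₁⁻¹ a < a < b < h₂ b` for the
linear order on `L_g` preserved by `g` with `x < g x` for all `x ∈ L_g`. -/
theorem bridge_subset_axis_and_ordered
    {T : Type*} [MetricSpace T] (hT : IsRTree T)
    {G : Type*} [Group G] [MulAction G T]
    (hact : ActsByWeakHomeos G T) (hnn : NonNesting G T)
    (h₁ h₂ : G) (hlox₁ : ¬ ∃ t : T, h₁ • t = t) (hlox₂ : ¬ ∃ t : T, h₂ • t = t)
    (hconj : IsConj h₁ h₂) (g : G) (hgdef : g = h₂ * h₁)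
    (hgconj : IsConj g (h₁ ^ 6) ∨ IsConj g (h₁⁻¹ ^ 6))
    (L₁ L₂ : Set T) (hL₁ : IsAxis h₁ L₁) (hL₂ : IsAxis h₂ L₂)
    (hdisj : L₁ ∩ L₂ = ∅)
    (a b : T) (ha : a ∈ L₁) (hb : b ∈ L₂)
    (hbridge : ∀ x ∈ L₁, ∀ y ∈ L₂, seg a b ⊆ seg x y) :
    (¬ ∃ t : T, g • t = t) ∧
      ∀ L : Set T, IsAxis g L →
        (seg (h₁⁻¹ • a) a ∪ seg a b ∪ seg b (h₂ • b) ⊆ L) ∧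
          ∀ lt : T → T → Prop, CompatOrder L lt → (∀ x ∈ L, lt x (g • x)) →
            lt (h₁⁻¹ • a) a ∧ lt a b ∧ lt b (h₂ • b) := by
  subst hgdef
  set p := h₁⁻¹ • a with hpdef
  have inv1 : ∀ x ∈ L₁, h₁ • x ∈ L₁ := fun x hx => by
    rw [← hL₁.2]; exact ⟨x, hx, rfl⟩
  have inv1' : ∀ x ∈ L₁, h₁⁻¹ • x ∈ L₁ := fun x hx => by
    rw [← hL₁.2] at hx
    obtain ⟨y, hy, rfl⟩ := hx
    simpa using hy
  have inv2 : ∀ x ∈ L₂, h₂ • x ∈ L₂ := fun x hx => by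
    rw [← hL₂.2]; exact ⟨x, hx, rfl⟩
  have inv2' : ∀ x ∈ L₂, h₂⁻¹ • x ∈ L₂ := fun x hx => by
    rw [← hL₂.2] at hx
    obtain ⟨y, hy, rfl⟩ := hx
    simpa using hy
  have hab : a ≠ b := by
    rintro rfl
    have : a ∈ L₁ ∩ L₂ := ⟨ha, hb⟩
    rw [hdisj] at this
    exact this
  have brl : ∀ x ∈ L₁, MB x a b := fun x hx =>
    MB_of_mem_seg hT (hbridge x hx b hb (left_mem_seg' hT a b))
  have brr : ∀ y ∈ L₂, MB a b y := fun y hy =>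
    MB_of_mem_seg hT (hbridge a ha y hy (right_mem_seg' hT a b))
  have hh1p : h₁ • p = a := smul_inv_smul _ _
  have hgp : (h₂ * h₁) • p = h₂ • a := by rw [mul_smul, hh1p]
  have hpa : p ≠ a := fun e => hlox₁ ⟨p, by rw [hh1p, e]⟩
  have hbb : b ≠ h₂ • b := fun e => hlox₂ ⟨b, e.symm⟩
  have s1 : MB p a b := brl p (inv1' a ha)
  have s2 : MB a b (h₂ • b) := brr _ (inv2 b hb)
  have s3 : MB b (h₂ • b) (h₂ • a) := by
    have := ((brr _ (inv2' b hb)).smul hT hact h₂).symm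
    rwa [smul_inv_smul] at this
  have s4 : MB (h₂ • b) (h₂ • a) (h₂ • h₁ • a) :=
    ((brl _ (inv1 a ha)).smul hT hact h₂).symm
  have hba2 : h₂ • b ≠ h₂ • a := fun e => hab (MulAction.injective h₂ e).symm
  -- the five points are aligned
  have t2 : MB a b (h₂ • a) := s2.chain' hT s3 hbb
  have t1 : MB p a (h₂ • a) := s1.chain' hT t2 hab
  have t3 : MB p (h₂ • b) (h₂ • a) := t1.sub (t2.sub s3)
  have t4 : MB p (h₂ • a) (h₂ • h₁ • a) := t3.chain hT s4 hba2
  have hp : MB p ((h₂ * h₁) • p) ((h₂ * h₁) • (h₂ * h₁) • p) := by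
    have := t1.smul hT hact (h₂ * h₁)
    rw [hgp] at this ⊢
    rw [mul_smul h₂ h₁ a] at this
    refine t4.chain' hT this ?_ |> fun h => h
    intro e
    exact hlox₁ ⟨a, (MulAction.injective h₂ e).symm⟩
  have hne : (h₂ * h₁) • p ≠ p := by
    intro e
    rw [hgp] at e
    rw [e] at t1
    unfold MB at t1
    have h0 := dist_self p
    have h1 := dist_nonneg (x := a) (y := p)
    have : dist p a ≤ 0 := by linarith
    exact hpa (dist_le_zero.1 this)
  have hlox := lox_of_aligned hT hact hnn (h₂ * h₁) hp hne
  refine ⟨hlox, ?_⟩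
  intro L hL
  obtain ⟨hpL, hgpL⟩ := mem_axis hT hact hnn (h₂ * h₁) hlox hp hL
  rw [hgp] at hgpL
  have conv := hL.1.1
  have haL : a ∈ L := conv _ hpL _ hgpL ((mem_seg_iff hT).2 t1)
  have hbL : b ∈ L := conv _ haL _ hgpL ((mem_seg_iff hT).2 t2)
  have hcL : h₂ • b ∈ L := conv _ hbL _ hgpL ((mem_seg_iff hT).2 s3)
  refine ⟨union_subset (union_subset (conv _ hpL _ haL) (conv _ haL _ hbL)) (conv _ hbL _ hcL), ?_⟩
  intro lt hlt hg
  obtain ⟨irr, tr, tot, comp⟩ := hlt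
  have step : ∀ x ∈ L, ∀ y ∈ L, ∀ z ∈ L, MB x z y → z ≠ x → z ≠ y → lt x y →
      lt x z ∧ lt z y := by
    intro x hx y hy z hz h h1 h2 hxy
    rcases (comp x hx y hy z hz).1 ((mem_seg_iff hT).2 h) with h | h | h | h
    · exact absurd h h1
    · exact absurd h h2
    · exact h
    · exact absurd (tr x hx y hy x hx hxy (tr y hy z hz x hx h.1 h.2)) (irr x hx)
  have l0 : lt p (h₂ • a) := by rw [← hgp]; exact hg p hpL
  have hne1 : ∀ {x y z : T}, MB x y z → x ≠ y → y ≠ z → x ≠ z := by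
    rintro x y z h h1 - rfl
    unfold MB at h
    have h0 := dist_self x
    have h3 := dist_nonneg (x := y) (y := x)
    have : dist x y ≤ 0 := by linarith
    exact h1 (dist_le_zero.1 this)
  have hb2a : b ≠ h₂ • a := hne1 s3 hbb hba2
  have ha2a : a ≠ h₂ • a := hne1 t2 hab hb2a
  have l1 := step p hpL _ hgpL a haL t1 hpa.symm ha2a l0
  have l2 := step a haL _ hgpL b hbL t2 hab.symm hb2a l1.2
  have l3 := step b hbL _ hgpL _ hcL s3 hbb.symm hba2 l2.2
  exact ⟨l1.1, l2.1, l3.1⟩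
end

section
/- Let T be an ℝ-tree and let S ⊆ T be a convex subset. Then S is closed in T (for the topology induced by the metric) if and only if S ∩ I is closed in I for every segment I ⊆ T. -/
open Set

lemma isArc_of_Icc {T : Type*} [MetricSpace T] {h : ℝ → T} {L : ℝ} (hL : 0 < L)
    (hc : ContinuousOn h (Icc 0 L)) (hi : InjOn h (Icc 0 L)) :
    IsArc (h '' Icc 0 L) (h 0) (h L) := by
  have hm : MapsTo (fun r : ℝ => L * r) (Icc 0 1) (Icc 0 L) := by
    intro r hr
    exact ⟨mul_nonneg hL.le hr.1, by nlinarith [hr.2]⟩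
  refine ⟨fun r => h (L * r), ?_, ?_, ?_, by simp, by simp⟩
  · exact hc.comp (by fun_prop) hm
  · intro r hr r' hr' e
    exact mul_left_cancel₀ hL.ne' (hi (hm hr) (hm hr') e)
  · ext p
    constructor
    · rintro ⟨r, hr, rfl⟩
      exact ⟨_, hm hr, rfl⟩
    · rintro ⟨r, hr, rfl⟩
      refine ⟨r / L, ⟨div_nonneg hr.1 hL.le, (div_le_one hL).2 hr.2⟩, ?_⟩
      show h (L * (r / L)) = h r
      rw [mul_div_cancel₀ _ hL.ne']

lemma seg_eq_of_isArc {T : Type*} [MetricSpace T] (hT : IsRTree T) {x y : T} (hxy : x ≠ y)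
    {A : Set T} (hA : IsArc A x y) : seg x y = A := by
  have hu := hT.arc_existsUnique hxy
  have : {B : Set T | IsArc B x y} = {A} := by
    ext B
    exact ⟨fun hB => hu.unique hB hA, fun hB => by rw [mem_singleton_iff.1 hB]; exact hA⟩
  simp [seg, hxy, this]

lemma exists_param {T : Type*} [MetricSpace T] (hT : IsRTree T) (x y : T) :
    ∃ (L : ℝ) (g : ℝ → T), 0 ≤ L ∧
      (∀ s ∈ Icc 0 L, ∀ t ∈ Icc 0 L, dist (g s) (g t) = |s - t|) ∧
      g 0 = x ∧ g L = y ∧ g '' Icc 0 L = seg x y := by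
  by_cases hxy : x = y
  · subst hxy
    refine ⟨0, fun _ => x, le_rfl, ?_, rfl, rfl, by simp [seg]⟩
    intro s hs t ht
    have hs' : s = 0 := le_antisymm hs.2 hs.1
    have ht' : t = 0 := le_antisymm ht.2 ht.1
    simp [hs', ht']
  · obtain ⟨A, hA, -⟩ := hT.arc_existsUnique hxy
    obtain ⟨a, b, g, hab, hg, him⟩ := hT.arc_isometric hxy A hA
    obtain ⟨f, -, -, hf, f0, f1⟩ := hA
    have hx : x ∈ g '' Icc a b := by rw [him, ← hf, ← f0]; exact ⟨0, by simp, rfl⟩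
    have hy : y ∈ g '' Icc a b := by rw [him, ← hf, ← f1]; exact ⟨1, by simp, rfl⟩
    obtain ⟨s, hs, hsx⟩ := hx
    obtain ⟨t, ht, hty⟩ := hy
    have key : ∃ (L : ℝ) (k : ℝ → T), 0 ≤ L ∧
      (∀ s ∈ Icc 0 L, ∀ t ∈ Icc 0 L, dist (k s) (k t) = |s - t|) ∧
      k 0 = x ∧ k L = y := by
      rcases le_total s t with h | h
      · refine ⟨t - s, fun r => g (s + r), by linarith, ?_, by simpa using hsx, by simpa using hty⟩
        intro u hu v hv
        have := hg (s + u) ⟨by linarith [hs.1, hu.1], by linarith [ht.2, hu.2]⟩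
          (s + v) ⟨by linarith [hs.1, hv.1], by linarith [ht.2, hv.2]⟩
        rw [this]; congr 1; ring
      · refine ⟨s - t, fun r => g (s - r), by linarith, ?_, by simpa using hsx, by simpa using hty⟩
        intro u hu v hv
        have := hg (s - u) ⟨by linarith [ht.1, hu.2], by linarith [hs.2, hu.1]⟩
          (s - v) ⟨by linarith [ht.1, hv.2], by linarith [hs.2, hv.1]⟩
        rw [this, abs_sub_comm u v]; congr 1; ring
    obtain ⟨L, k, hL, hk, k0, kL⟩ := key
    refine ⟨L, k, hL, hk, k0, kL, ?_⟩
    have hL' : 0 < L := by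
      rcases hL.lt_or_eq with h | h
      · exact h
      · exact absurd (by rw [← k0, ← kL, ← h]) hxy
    have harc := isArc_of_Icc (h := k) hL' ?_ ?_
    · rw [k0, kL] at harc
      exact (seg_eq_of_isArc hT hxy harc).symm
    · have : LipschitzOnWith 1 k (Icc 0 L) := by
        apply LipschitzOnWith.of_dist_le_mul
        intro u hu v hv
        rw [hk u hu v hv, Real.dist_eq]; simp
      exact this.continuousOn
    · intro u hu v hv e
      have := hk u hu v hv
      rw [e, dist_self] at this
      exact sub_eq_zero.1 (abs_eq_zero.1 this.symm)

lemma param_cont {T : Type*} [MetricSpace T] {k : ℝ → T} {L : ℝ}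
    (hk : ∀ s ∈ Icc 0 L, ∀ t ∈ Icc 0 L, dist (k s) (k t) = |s - t|) :
    ContinuousOn k (Icc 0 L) := by
  have : LipschitzOnWith 1 k (Icc 0 L) := by
    apply LipschitzOnWith.of_dist_le_mul
    intro u hu v hv
    rw [hk u hu v hv, Real.dist_eq]; simp
  exact this.continuousOn

lemma param_inj {T : Type*} [MetricSpace T] {k : ℝ → T} {L : ℝ}
    (hk : ∀ s ∈ Icc 0 L, ∀ t ∈ Icc 0 L, dist (k s) (k t) = |s - t|) :
    InjOn k (Icc 0 L) := by
  intro u hu v hv e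
  have := hk u hu v hv
  rw [e, dist_self] at this
  exact sub_eq_zero.1 (abs_eq_zero.1 this.symm)

lemma seg_subset_union {T : Type*} [MetricSpace T] (hT : IsRTree T) {x z : T} (y : T)
    (hxz : x ≠ z) : seg x z ⊆ seg x y ∪ seg y z := by
  obtain ⟨a, f, ha, hf, f0, fa, fim⟩ := exists_param hT x y
  obtain ⟨b, g, hb, hg, g0, gb, gim⟩ := exists_param hT y z
  have fc := param_cont hf
  have gc := param_cont hg
  have fi := param_inj hf
  have gi := param_inj hg
  have hcomp : IsCompact (Icc 0 a ∩ f ⁻¹' (g '' Icc 0 b)) := by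
    apply isCompact_Icc.of_isClosed_subset _ inter_subset_left
    exact fc.preimage_isClosed_of_isClosed isClosed_Icc (isCompact_Icc.image_of_continuousOn gc).isClosed
  obtain ⟨t0, ⟨ht0, u0, hu0, hgu⟩, hmin⟩ := hcomp.exists_isLeast
    ⟨a, ⟨ha, le_rfl⟩, 0, ⟨le_rfl, hb⟩, by rw [g0, fa]⟩
  set h : ℝ → T := fun t => if t ≤ t0 then f t else g (u0 + (t - t0)) with hh
  have hL : 0 ≤ t0 + (b - u0) := by linarith [ht0.1, hu0.2]
  have h0 : h 0 = x := by simp [hh, ht0.1, f0]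
  have hend : h (t0 + (b - u0)) = z := by
    rcases hu0.2.lt_or_eq with e | e
    · simp [hh, e, gb]
    · simp [hh, e, ← gb, ← hgu]
  have hL' : 0 < t0 + (b - u0) := by
    rcases hL.lt_or_eq with e | e
    · exact e
    · exact absurd (by rw [← h0, ← hend, ← e]) hxz
  have hc : ContinuousOn h (Icc 0 (t0 + (b - u0))) := by
    have e : Icc 0 (t0 + (b - u0)) = Icc 0 t0 ∪ Icc t0 (t0 + (b - u0)) :=
      (Icc_union_Icc_eq_Icc ht0.1 (by linarith [hu0.2])).symm
    rw [e]
    apply ContinuousOn.union_of_isClosed _ _ isClosed_Icc isClosed_Icc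
    · apply (fc.mono (Icc_subset_Icc_right ht0.2)).congr
      intro t ht
      simp [hh, ht.2]
    · have : ContinuousOn (fun t => g (u0 + (t - t0))) (Icc t0 (t0 + (b - u0))) := by
        apply gc.comp (by fun_prop)
        intro t ht
        exact ⟨by linarith [hu0.1, ht.1], by linarith [ht.2]⟩
      apply this.congr
      intro t ht
      rcases ht.1.lt_or_eq with e | e
      · simp [hh, e]
      · simp [hh, ← e, hgu]
  have cross : ∀ s ∈ Icc 0 (t0 + (b - u0)), ∀ t ∈ Icc 0 (t0 + (b - u0)),
      s ≤ t0 → t0 < t → f s ≠ g (u0 + (t - t0)) := by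
    intro s hs t ht h1 h2 e
    have hm : u0 + (t - t0) ∈ Icc 0 b := ⟨by linarith [hu0.1], by linarith [ht.2]⟩
    have : t0 ≤ s := hmin ⟨⟨hs.1, h1.trans ht0.2⟩, _, hm, e.symm⟩
    have e' : s = t0 := le_antisymm h1 this
    rw [e', ← hgu] at e
    have := gi hu0 hm e
    linarith
  have hi : InjOn h (Icc 0 (t0 + (b - u0))) := by
    intro s hs t ht e
    simp only [hh] at e
    split_ifs at e with h1 h2 h2
    · exact fi ⟨hs.1, h1.trans ht0.2⟩ ⟨ht.1, h2.trans ht0.2⟩ e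
    · exact absurd e (cross s hs t ht h1 (not_le.1 h2))
    · exact absurd e.symm (cross t ht s hs h2 (not_le.1 h1))
    · have := gi ⟨by linarith [hu0.1], by linarith [hs.2]⟩ ⟨by linarith [hu0.1], by linarith [ht.2]⟩ e
      linarith
  have harc := isArc_of_Icc hL' hc hi
  rw [h0, hend] at harc
  rw [seg_eq_of_isArc hT hxz harc, ← fim, ← gim]
  rintro _ ⟨t, ht, rfl⟩
  simp only [hh]
  split_ifs with h1
  · exact Or.inl ⟨t, ⟨ht.1, h1.trans ht0.2⟩, rfl⟩
  · exact Or.inr ⟨_, ⟨by linarith [hu0.1], by linarith [ht.2]⟩, rfl⟩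

/-- A convex subset `S` of an `ℝ`-tree is closed iff `S ∩ I`
is closed in `I` for every segment `I`. -/
theorem convex_isClosed_iff_closed_in_segments
    {T : Type*} [MetricSpace T] (hT : IsRTree T)
    (S : Set T) (hS : ConvexSubtree S) :
    IsClosed S ↔ ∀ x y : T, IsClosed {p : seg x y | (p : T) ∈ S} := by
  constructor
  · intro h x y
    exact h.preimage continuous_subtype_val
  · intro H
    apply isClosed_of_closure_subset
    intro x hx
    by_contra hxS
    obtain ⟨s, hs⟩ : S.Nonempty := closure_nonempty_iff.1 ⟨x, hx⟩
    have hxs : x ≠ s := fun e => hxS (e ▸ hs)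
    obtain ⟨L, g, hL, hg, g0, gL, gim⟩ := exists_param hT x s
    have hxm : x ∈ seg x s := by rw [← gim]; exact ⟨0, ⟨le_rfl, hL⟩, g0⟩
    have hsm : s ∈ seg x s := by rw [← gim]; exact ⟨L, ⟨hL, le_rfl⟩, gL⟩
    obtain ⟨ε, hε, hball⟩ := Metric.isOpen_iff.1 (H x s).isOpen_compl ⟨x, hxm⟩ hxS
    have far : ∀ p ∈ seg x s, dist p x < ε → p ∉ S := fun p hp hd => 
      hball (show (⟨p, hp⟩ : seg x s) ∈ Metric.ball ⟨x, hxm⟩ ε from hd)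
    have hLd : dist s x = L := by
      rw [← g0, ← gL, hg L ⟨hL, le_rfl⟩ 0 ⟨le_rfl, hL⟩, sub_zero, abs_of_nonneg hL]
    have hεL : ε ≤ L := by
      by_contra hlt
      exact far s hsm (by rw [hLd]; exact not_le.1 hlt) hs
    obtain ⟨y, hy, hxy⟩ := Metric.mem_closure_iff.1 hx ε hε
    obtain ⟨δ, hδ1, hδ2⟩ := exists_between hxy
    have hδ0 : 0 ≤ δ := dist_nonneg.trans hδ1.le
    have hδm : δ ∈ Icc 0 L := ⟨hδ0, hδ2.le.trans hεL⟩
    have hp : g δ ∈ seg x s := by rw [← gim]; exact ⟨δ, hδm, rfl⟩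
    have hpd : dist (g δ) x = δ := by
      rw [← g0, hg δ hδm 0 ⟨le_rfl, hL⟩, sub_zero, abs_of_nonneg hδ0]
    have hpS := far _ hp (by rw [hpd]; exact hδ2)
    rcases seg_subset_union hT y hxs hp with h | h
    · obtain ⟨M, k, hM, hk, k0, kM, kim⟩ := exists_param hT x y
      rw [← kim] at h
      obtain ⟨r, hr, hrp⟩ := h
      have e1 : dist (g δ) x = r := by
        rw [← hrp, ← k0, hk r hr 0 ⟨le_rfl, hM⟩, sub_zero, abs_of_nonneg hr.1]
      have e2 : dist x y = M := by
        rw [dist_comm, ← k0, ← kM, hk M ⟨hM, le_rfl⟩ 0 ⟨le_rfl, hM⟩, sub_zero, abs_of_nonneg hM]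
      linarith [hr.2]
    · exact hpS (hS y hy s hs h)
end
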